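/- arXiv:2009.06486 — 2 statements merged into one kernel-verified Lean document; each statement's English description precedes it below -/
import Mathlib

section
/- Counterexample to gradient regularity for large opening angle (Theorem 1.2(i) / Section 6, case θ₀ ∈ (π/2,π)). Let θ₀ ∈ (π/2, π). There exists s₀ ∈ (−π+θ₀, 0), depending on θ₀, such that for every s with s ∈ (−π+θ₀, s₀) or s ∈ (π/2, θ₀) there exist α = α(θ₀, s) ∈ (0,1) and a function u : 𝒞̄ → ℝ with the following properties: u is continuous on 𝒞̄ and smooth on 𝒞̄ ∖ {0}; u is axi-symmetric; u is positively homogeneous of degree α (u(λx) = λ^α u(x) for all λ > 0 and x ∈ 𝒞̄); u is not identically zero; Δu = 0 in 𝒞; and β·Du = 0 at every point of Γ_cone, where β(x) = sin(s)·(x'/|x'|, 0) + cos(s)·e₃. Consequently u is α-Hölder continuous on 𝒞̄ ∩ B₁(0), but for every ε > 0 the function u is not (α+ε)-Hölder continuous in any neighbourhood of the origin; in particular u is not C¹ up to the origin. -/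
noncomputable section
open Real Set

abbrev Euc3 := EuclideanSpace ℝ (Fin 3)

/-- Partial derivative in the `i`-th coordinate direction. -/
def pd3 (i : Fin 3) (u : Euc3 → ℝ) (x : Euc3) : ℝ :=
  fderiv ℝ u x (EuclideanSpace.single i 1)

/-- Second partial derivative `∂_i ∂_j u`. -/
def pd3₂ (i j : Fin 3) (u : Euc3 → ℝ) (x : Euc3) : ℝ :=
  pd3 i (pd3 j u) x

/-- The Laplacian on `ℝ³`. -/
def lap3 (u : Euc3 → ℝ) (x : Euc3) : ℝ := ∑ i : Fin 3, pd3₂ i i u x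

/-- The polar angle `θ(x) ∈ [0,π]`, defined by `‖x‖ cos θ = x₃`. -/
def polarAngle3 (x : Euc3) : ℝ := Real.arccos (x 2 / ‖x‖)

/-- The open cone `𝒞 = {x : r > 0, θ(x) < θ₀}`. -/
def cone3 (θ₀ : ℝ) : Set Euc3 := {x | 0 < ‖x‖ ∧ polarAngle3 x < θ₀}

/-- The lateral boundary `Γ_cone = {x ≠ 0 : θ(x) = θ₀}`. -/
def coneBdry3 (θ₀ : ℝ) : Set Euc3 := {x | 0 < ‖x‖ ∧ polarAngle3 x = θ₀}

/-- Axi-symmetry: `u` depends only on `(x₃, |x'|)`. -/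
def axisym3 (u : Euc3 → ℝ) : Prop :=
  ∀ x x' : Euc3, x 2 = x' 2 → (x 0) ^ 2 + (x 1) ^ 2 = (x' 0) ^ 2 + (x' 1) ^ 2 → u x = u x'

/-- The boundary vector field `β(x) = sin s · (x'/|x'|, 0) + cos s · e₃`. -/
def obliqueVec3 (s : ℝ) (x : Euc3) : Euc3 :=
  (WithLp.equiv 2 (Fin 3 → ℝ)).symm
    ![Real.sin s * x 0 / Real.sqrt ((x 0) ^ 2 + (x 1) ^ 2),
      Real.sin s * x 1 / Real.sqrt ((x 0) ^ 2 + (x 1) ^ 2),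
      Real.cos s]

/-- All the properties asserted of the counterexample solution `u`:
continuity on `𝒞̄`, smoothness away from the vertex, axi-symmetry, positive
`α`-homogeneity, non-triviality, harmonicity, the homogeneous oblique boundary
condition, `α`-Hölder continuity near the vertex, failure of `(α+ε)`-Hölder
continuity in every neighbourhood of the vertex, and failure of `C¹` regularity
up to the vertex. -/
def counterexampleProps (θ₀ s α : ℝ) (u : Euc3 → ℝ) : Prop :=
  ContinuousOn u (closure (cone3 θ₀)) ∧
  ContDiffOn ℝ (⊤ : ℕ∞) u (closure (cone3 θ₀) \ {0}) ∧
  axisym3 u ∧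
  (∀ l : ℝ, 0 < l → ∀ x ∈ closure (cone3 θ₀), u (l • x) = l ^ α * u x) ∧
  (∃ x ∈ closure (cone3 θ₀), u x ≠ 0) ∧
  (∀ x ∈ cone3 θ₀, lap3 u x = 0) ∧
  (∀ x ∈ coneBdry3 θ₀, fderivWithin ℝ u (closure (cone3 θ₀)) x (obliqueVec3 s x) = 0) ∧
  (∃ K : NNReal, HolderOnWith K α.toNNReal u (closure (cone3 θ₀) ∩ Metric.closedBall 0 1)) ∧
  (∀ ε : ℝ, 0 < ε → ∀ K : NNReal, ∀ δ : ℝ, 0 < δ →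
    ¬ HolderOnWith K (α + ε).toNNReal u (closure (cone3 θ₀) ∩ Metric.ball 0 δ)) ∧
  ¬ ∃ G : Euc3 → (Euc3 →L[ℝ] ℝ), ContinuousOn G (closure (cone3 θ₀)) ∧
      ∀ x ∈ closure (cone3 θ₀) \ {0}, G x = fderivWithin ℝ u (closure (cone3 θ₀)) x

/-! ### Power series with polynomially bounded coefficients -/

def psS (a : ℕ → ℝ) (w : ℝ) : ℝ := ∑' n, a n * w ^ n

def psD (a : ℕ → ℝ) : ℕ → ℝ := fun n => ((n : ℝ) + 1) * a (n + 1)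

def psAdm (a : ℕ → ℝ) : Prop := ∃ C : ℝ, ∃ k : ℕ, 0 ≤ C ∧ ∀ n, |a n| ≤ C * ((n : ℝ) + 1) ^ k

lemma ps_summable_bd (k : ℕ) (C r : ℝ) (h0 : 0 ≤ r) (h : r < 1) :
    Summable (fun n : ℕ => C * ((n : ℝ) + 1) ^ k * r ^ n) := by
  have h1 : Summable (fun n : ℕ => ((n : ℝ) ^ k * r ^ n)) :=
    summable_pow_mul_geometric_of_norm_lt_one k (by rwa [Real.norm_of_nonneg h0])
  have h2 : Summable (fun n : ℕ => r ^ n) := summable_geometric_of_lt_one h0 h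
  have h3 : Summable (fun n : ℕ => |C| * (2 ^ k * ((n : ℝ) ^ k * r ^ n + r ^ n))) :=
    ((h1.add h2).mul_left _).mul_left _
  refine h3.of_norm_bounded ?_
  intro n
  have hr : 0 ≤ r ^ n := pow_nonneg h0 n
  rw [Real.norm_eq_abs, abs_mul, abs_mul, abs_of_nonneg hr, mul_assoc]
  refine mul_le_mul_of_nonneg_left ?_ (abs_nonneg _)
  have hn : (0:ℝ) ≤ n := Nat.cast_nonneg n
  rw [abs_of_nonneg (by positivity)]
  have : ((n:ℝ) + 1) ^ k ≤ 2 ^ k * ((n:ℝ) ^ k + 1) := by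
    rcases Nat.eq_zero_or_pos n with hz | hp
    · subst hz
      have h1 : (1:ℝ) ≤ 2 ^ k := one_le_pow₀ (by norm_num)
      have h2 : (0:ℝ) ≤ 0 ^ k := by positivity
      simp only [Nat.cast_zero, zero_add, one_pow]
      nlinarith
    · have h1 : (1:ℝ) ≤ n := by exact_mod_cast hp
      have : ((n:ℝ) + 1) ^ k ≤ (2 * n) ^ k := by
        apply pow_le_pow_left₀ (by positivity); linarith
      rw [mul_pow] at this
      have h2 : (0:ℝ) ≤ 2 ^ k := by positivity
      nlinarith
  nlinarith

lemma psAdm_D {a : ℕ → ℝ} (h : psAdm a) : psAdm (psD a) := by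
  obtain ⟨C, k, hC, h⟩ := h
  refine ⟨C * 2 ^ k, k + 1, by positivity, fun n => ?_⟩
  have h1 := h (n + 1)
  have hn : (0:ℝ) ≤ n := Nat.cast_nonneg n
  unfold psD
  rw [abs_mul, abs_of_nonneg (by positivity : (0:ℝ) ≤ (n:ℝ) + 1)]
  push_cast at h1
  have h2 : ((n:ℝ) + 1 + 1) ^ k ≤ (2 * ((n:ℝ) + 1)) ^ k := by
    apply pow_le_pow_left₀ (by positivity); linarith
  calc ((n:ℝ) + 1) * |a (n + 1)| ≤ ((n:ℝ) + 1) * (C * (2 * ((n:ℝ) + 1)) ^ k) := by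
        gcongr
        exact h1.trans (by gcongr)
    _ = _ := by rw [mul_pow]; ring

lemma ps_summable {a : ℕ → ℝ} (h : psAdm a) {w : ℝ} (hw : |w| < 1) :
    Summable (fun n => a n * w ^ n) := by
  obtain ⟨C, k, hC, h⟩ := h
  refine (ps_summable_bd k C |w| (abs_nonneg _) hw).of_norm_bounded fun n => ?_
  rw [Real.norm_eq_abs, abs_mul, abs_pow]
  gcongr
  exact h n

lemma ps_hasSum {a : ℕ → ℝ} (h : psAdm a) {w : ℝ} (hw : |w| < 1) :
    HasSum (fun n => a n * w ^ n) (psS a w) := (ps_summable h hw).hasSum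

lemma ps_hasSum_D {a : ℕ → ℝ} (h : psAdm a) {w : ℝ} (hw : |w| < 1) :
    HasSum (fun n => a n * ((n : ℝ) * w ^ (n - 1))) (psS (psD a) w) := by
  have h1 := ps_hasSum (psAdm_D h) hw
  rw [← hasSum_nat_add_iff' 1]
  simp only [Finset.range_one, Finset.sum_singleton, Nat.cast_zero, zero_mul, mul_zero, sub_zero]
  refine h1.congr_fun ?_ 
  intro n
  simp only [psD, Nat.add_sub_cancel]
  push_cast; ring

lemma ps_hasDerivAt {a : ℕ → ℝ} (h : psAdm a) {w : ℝ} (hw : |w| < 1) :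
    HasDerivAt (psS a) (psS (psD a) w) w := by
  rw [← (ps_hasSum_D h hw).tsum_eq]
  obtain ⟨r, hr, hr1⟩ := exists_between hw
  have hr0 : 0 < r := lt_of_le_of_lt (abs_nonneg _) hr
  obtain ⟨C, k, hC, hb⟩ := id h
  have hsum : Summable (fun n : ℕ => |a n| * ((n:ℝ) * r ^ (n - 1))) := by
    have habs : psAdm (fun n => |a n|) := ⟨C, k, hC, fun n => by simpa using hb n⟩
    exact (ps_hasSum_D habs (w := r) (by rwa [abs_of_pos hr0])).summable
  refine hasDerivAt_tsum_of_isPreconnected (t := Ioo (-r) r) (y₀ := 0) hsum isOpen_Ioo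
    isPreconnected_Ioo (g := fun n y => a n * y ^ n)
    (g' := fun n y => a n * ((n : ℝ) * y ^ (n - 1))) ?_ ?_ ?_ ?_ ?_
  · intro n y hy
    exact (hasDerivAt_pow n y).const_mul _
  · intro n y hy
    rw [Real.norm_eq_abs, abs_mul, abs_mul, abs_pow, abs_of_nonneg (Nat.cast_nonneg n : (0:ℝ) ≤ n)]
    have : |y| ≤ r := (abs_lt.2 hy).le
    gcongr
  · exact ⟨by linarith, hr0⟩
  · exact ps_summable h (by simp)
  · exact abs_lt.1 hr

lemma ps_contDiffOn {a : ℕ → ℝ} (h : psAdm a) :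
    ContDiffOn ℝ (⊤ : ℕ∞) (psS a) (Ioo (-1) 1) := by
  rw [contDiffOn_infty]
  intro n
  induction n generalizing a with
  | zero =>
    rw [Nat.cast_zero, contDiffOn_zero]
    intro w hw
    exact (ps_hasDerivAt h (abs_lt.2 hw)).continuousAt.continuousWithinAt
  | succ n ih =>
    push_cast
    rw [contDiffOn_succ_iff_deriv_of_isOpen isOpen_Ioo]
    refine ⟨fun w hw => (ps_hasDerivAt h (abs_lt.2 hw)).differentiableAt.differentiableWithinAt,
      by simp, ?_⟩
    exact (ih (psAdm_D h)).congr fun w hw => (ps_hasDerivAt h (abs_lt.2 hw)).deriv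

lemma ps_ode {a : ℕ → ℝ} (h : psAdm a) {l : ℝ}
    (hrec : ∀ n : ℕ, ((n:ℝ) + 1) ^ 2 * a (n + 1) = ((n:ℝ) * (n + 1) - l) * a n)
    {w : ℝ} (hw : |w| < 1) :
    w * (1 - w) * psS (psD (psD a)) w + (1 - 2 * w) * psS (psD a) w + l * psS a w = 0 := by
  have h0 := ps_hasSum h hw
  have h1 := ps_hasSum (psAdm_D h) hw
  have h1' : HasSum (fun n : ℕ => (n:ℝ) * a n * w ^ n) (w * psS (psD a) w) := by
    refine ((ps_hasSum_D h hw).mul_left w).congr_fun ?_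
    intro n
    rcases n with _ | n
    · simp
    · simp only [Nat.add_sub_cancel]; push_cast; ring
  have h2' : HasSum (fun n : ℕ => (n:ℝ) * psD a n * w ^ n) (w * psS (psD (psD a)) w) := by
    refine ((ps_hasSum_D (psAdm_D h) hw).mul_left w).congr_fun ?_
    intro n
    rcases n with _ | n
    · simp
    · simp only [Nat.add_sub_cancel]; push_cast; ring
  have h2'' : HasSum (fun n : ℕ => (n:ℝ) * (n - 1) * a n * w ^ n)
      (w * (w * psS (psD (psD a)) w)) := by
    rw [← hasSum_nat_add_iff' 1]
    simp only [Finset.range_one, Finset.sum_singleton, Nat.cast_zero, zero_mul, sub_zero]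
    refine (h2'.mul_left w).congr_fun ?_
    intro n
    simp only [psD]; push_cast; ring
  have hs := (((h2'.sub h2'').add h1).sub (h1'.mul_left 2)).add (h0.mul_left l)
  have hz : HasSum (fun _ : ℕ => (0:ℝ)) 0 := hasSum_zero
  have := hs.unique (hz.congr_fun ?_)
  · linarith
  · intro n
    simp only [psD]
    linear_combination w ^ n * hrec n

/-! ### Legendre coefficients -/

def legB (α : ℝ) : ℕ → ℝ
  | 0 => -(α + 1)
  | (n + 1) => legB α n * ((((n:ℝ) + 1) * (n + 2) - α * (α + 1)) / ((n:ℝ) + 2) ^ 2)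

def legA (α : ℝ) : ℕ → ℝ
  | 0 => 1
  | (n + 1) => α * legB α n

def legE (α : ℝ) (n : ℕ) : ℝ := ((n:ℝ) + 1) * legB α n

lemma legB_bound {α : ℝ} (hα : α ∈ Icc (0:ℝ) 1) (n : ℕ) : |legB α n| ≤ 2 := by
  obtain ⟨h0, h1⟩ := hα
  induction n with
  | zero => simp only [legB]; rw [abs_le]; constructor <;> linarith
  | succ n ih =>
    have hn : (0:ℝ) ≤ n := Nat.cast_nonneg n
    simp only [legB]
    rw [abs_mul]
    have : |(((n:ℝ) + 1) * (n + 2) - α * (α + 1)) / ((n:ℝ) + 2) ^ 2| ≤ 1 := by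
      rw [abs_div, abs_of_pos (by positivity : (0:ℝ) < ((n:ℝ) + 2) ^ 2),
        div_le_one (by positivity), abs_le]
      constructor <;> nlinarith
    calc _ ≤ 2 * (1:ℝ) := by gcongr
      _ = 2 := by norm_num

lemma legA_bound {α : ℝ} (hα : α ∈ Icc (0:ℝ) 1) (n : ℕ) : |legA α n| ≤ 2 := by
  rcases n with _ | n
  · simp [legA]
  · simp only [legA]
    rw [abs_mul, abs_of_nonneg hα.1]
    have := legB_bound hα n
    have h2 := abs_nonneg (legB α n)
    nlinarith [hα.1, hα.2]

lemma legA_adm {α : ℝ} (hα : α ∈ Icc (0:ℝ) 1) : psAdm (legA α) :=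
  ⟨2, 0, by norm_num, fun n => by simpa using legA_bound hα n⟩

lemma legA_rec (α : ℝ) (n : ℕ) :
    ((n:ℝ) + 1) ^ 2 * legA α (n + 1) = ((n:ℝ) * (n + 1) - α * (α + 1)) * legA α n := by
  rcases n with _ | n
  · simp [legA, legB]; ring
  · simp only [legA, legB]
    have hn : (0:ℝ) ≤ n := Nat.cast_nonneg n
    have : ((n:ℝ) + 2) ≠ 0 := by positivity
    push_cast
    field_simp
    ring

lemma legA_D (α : ℝ) (w : ℝ) : psS (psD (legA α)) w = α * psS (legE α) w := by
  unfold psS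
  rw [← tsum_mul_left]
  congr 1
  ext n
  simp only [psD, legA, legE]
  ring

lemma legB_cont (n : ℕ) : Continuous (fun α => legB α n) := by
  induction n with
  | zero => simp only [legB]; fun_prop
  | succ n ih => simp only [legB]; fun_prop

lemma legA_cont (n : ℕ) : Continuous (fun α => legA α n) := by
  rcases n with _ | n
  · simp only [legA]; fun_prop
  · simp only [legA]; have := legB_cont n; fun_prop

lemma legA_contOn {w : ℝ} (hw0 : 0 ≤ w) (hw : w < 1) :
    ContinuousOn (fun α => psS (legA α) w) (Icc 0 1) := by
  unfold psS
  refine continuousOn_tsum (u := fun n : ℕ => 2 * ((n:ℝ) + 1) ^ 0 * w ^ n) ?_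
    (ps_summable_bd 0 2 w hw0 hw) ?_
  · intro n
    exact ((legA_cont n).mul continuous_const).continuousOn
  · intro n α hα
    rw [Real.norm_eq_abs, abs_mul, abs_of_nonneg (pow_nonneg hw0 n)]
    have := legA_bound hα n
    simp only [pow_zero, mul_one]
    gcongr

lemma legE_contOn {w : ℝ} (hw0 : 0 ≤ w) (hw : w < 1) :
    ContinuousOn (fun α => psS (legE α) w) (Icc 0 1) := by
  unfold psS
  refine continuousOn_tsum (u := fun n : ℕ => 2 * ((n:ℝ) + 1) ^ 1 * w ^ n) ?_
    (ps_summable_bd 1 2 w hw0 hw) ?_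
  · intro n
    have := legB_cont n
    unfold legE
    fun_prop
  · intro n α hα
    have hn : (0:ℝ) ≤ n := Nat.cast_nonneg n
    rw [Real.norm_eq_abs, abs_mul, abs_of_nonneg (pow_nonneg hw0 n), legE, abs_mul,
      abs_of_nonneg (by positivity : (0:ℝ) ≤ (n:ℝ) + 1), pow_one, mul_comm 2]
    have := legB_bound hα n
    gcongr

lemma legA_zero (w : ℝ) : psS (legA 0) w = 1 := by
  unfold psS
  rw [tsum_eq_single 0]
  · simp [legA]
  · intro n hn
    obtain ⟨m, rfl⟩ := Nat.exists_eq_succ_of_ne_zero hn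
    simp [legA]

lemma legE_zero_coef (n : ℕ) : legE 0 n = -1 := by
  induction n with
  | zero => simp [legE, legB]
  | succ n ih =>
    have hn : (0:ℝ) ≤ n := Nat.cast_nonneg n
    simp only [legE, legB] at ih ⊢
    push_cast
    have h2 : ((n:ℝ) + 2) ≠ 0 := by positivity
    field_simp
    linear_combination ((n:ℝ) + 2) ^ 2 * ih

lemma legE_zero {w : ℝ} (hw0 : 0 ≤ w) (hw : w < 1) : psS (legE 0) w = -(1 - w)⁻¹ := by
  unfold psS
  simp only [legE_zero_coef]
  rw [tsum_mul_left, tsum_geometric_of_lt_one hw0 hw]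
  ring

lemma legB_one (n : ℕ) : legB 1 (n + 1) = 0 := by
  induction n with
  | zero => norm_num [legB]
  | succ n ih => rw [legB, ih, zero_mul]

lemma legA_one (w : ℝ) : psS (legA 1) w = 1 - 2 * w := by
  unfold psS
  rw [tsum_eq_sum (s := Finset.range 2)]
  · norm_num [Finset.sum_range_succ, legA, legB]; ring
  · intro n hn
    simp only [Finset.mem_range, not_lt] at hn
    obtain ⟨m, rfl⟩ := Nat.exists_eq_add_of_le' hn
    simp [legA, legB_one]

lemma legE_one (w : ℝ) : psS (legE 1) w = -2 := by
  unfold psS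
  rw [tsum_eq_sum (s := Finset.range 1)]
  · norm_num [legE, legB]
  · intro n hn
    simp only [Finset.mem_range, not_lt] at hn
    obtain ⟨m, rfl⟩ := Nat.exists_eq_add_of_le' hn
    simp [legE, legB_one]

lemma exists_alpha {θ₀ s : ℝ} (hθ₀ : θ₀ ∈ Ioo (π / 2) π)
    (hs : s ∈ Ioo (-π + θ₀) ((θ₀ - π) / 2) ∨ s ∈ Ioo (π / 2) θ₀) :
    ∃ α ∈ Ioo (0:ℝ) 1,
      α * psS (legA α) ((1 - cos θ₀) / 2) * cos (θ₀ - s)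
        - psS (psD (legA α)) ((1 - cos θ₀) / 2) / 2 * sin θ₀ * sin (θ₀ - s) = 0 := by
  obtain ⟨ht1, ht2⟩ := hθ₀
  have hpi := Real.pi_pos
  have hc1 : -1 < cos θ₀ := by
    have := Real.cos_lt_cos_of_nonneg_of_le_pi (by linarith : 0 ≤ θ₀) le_rfl ht2
    simpa using this
  have hcle := Real.cos_le_one θ₀
  set w := (1 - cos θ₀) / 2 with hw
  have hw0 : 0 ≤ w := by rw [hw]; linarith
  have hw1 : w < 1 := by rw [hw]; linarith
  set G : ℝ → ℝ := fun α => psS (legA α) w * cos (θ₀ - s)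
    - psS (legE α) w / 2 * sin θ₀ * sin (θ₀ - s) with hG
  have hcont : ContinuousOn G (Icc 0 1) := by
    have h1 := legA_contOn hw0 hw1
    have h2 := legE_contOn hw0 hw1
    rw [hG]
    fun_prop
  have hG1 : G 1 = cos s := by
    simp only [hG, legA_one, legE_one]
    have : s = θ₀ - (θ₀ - s) := by ring
    conv_rhs => rw [this, cos_sub]
    rw [hw]; ring
  have hch : 0 < cos (θ₀ / 2) := Real.cos_pos_of_mem_Ioo ⟨by linarith, by linarith⟩
  have hG0 : G 0 * cos (θ₀ / 2) = cos (θ₀ / 2 - s) := by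
    simp only [hG, legA_zero, legE_zero hw0 hw1]
    have e1 : 1 - w = cos (θ₀ / 2) ^ 2 := by
      have := Real.cos_sq (θ₀ / 2)
      rw [show 2 * (θ₀ / 2) = θ₀ by ring] at this
      rw [this, hw]; ring
    have e2 : sin θ₀ = 2 * sin (θ₀ / 2) * cos (θ₀ / 2) := by
      rw [← Real.sin_two_mul]; congr 1; ring
    have e3 : θ₀ / 2 - s = (θ₀ - s) - θ₀ / 2 := by ring
    rw [e3, cos_sub (θ₀ - s) (θ₀ / 2), e1, e2]
    field_simp
    ring
  have key : ∃ α ∈ Ioo (0:ℝ) 1, G α = 0 := by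
    rcases hs with ⟨h1, h2⟩ | ⟨h1, h2⟩
    · have a1 : 0 < G 1 := by
        rw [hG1]; exact Real.cos_pos_of_mem_Ioo ⟨by linarith, by linarith⟩
      have a0 : G 0 < 0 := by
        have : cos (θ₀ / 2 - s) < 0 :=
          Real.cos_neg_of_pi_div_two_lt_of_lt (by linarith) (by linarith)
        rw [← hG0] at this
        by_contra hcon
        push Not at hcon
        have := mul_nonneg hcon hch.le
        linarith
      obtain ⟨α, hα, h⟩ := intermediate_value_Ioo zero_le_one hcont ⟨a0, a1⟩
      exact ⟨α, hα, h⟩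
    · have a1 : G 1 < 0 := by
        rw [hG1]; exact Real.cos_neg_of_pi_div_two_lt_of_lt h1 (by linarith)
      have a0 : 0 < G 0 := by
        have : 0 < cos (θ₀ / 2 - s) := Real.cos_pos_of_mem_Ioo ⟨by linarith, by linarith⟩
        rw [← hG0] at this
        exact pos_of_mul_pos_left this hch.le
      obtain ⟨α, hα, h⟩ := intermediate_value_Ioo' zero_le_one hcont ⟨a1, a0⟩
      exact ⟨α, hα, h⟩
  obtain ⟨α, hα, h⟩ := key
  refine ⟨α, hα, ?_⟩
  rw [legA_D]
  simp only [hG] at h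
  linear_combination α * h

/-! ### Homogeneous axisymmetric functions -/

def homU (p : ℝ) (ψ : ℝ → ℝ) (x : Euc3) : ℝ := ‖x‖ ^ p * ψ (x 2 / ‖x‖)

def homL (p : ℝ) (ψ ψ1 : ℝ → ℝ) (x : Euc3) : Euc3 →L[ℝ] ℝ :=
  (homU (p - 2) (fun z => p * ψ z - z * ψ1 z) x) • innerSL ℝ x
    + (homU (p - 1) ψ1 x) • (EuclideanSpace.proj 2 : Euc3 →L[ℝ] ℝ)

lemma norm_hasFDerivAt {x : Euc3} (hx : x ≠ 0) :
    HasFDerivAt (fun y : Euc3 => ‖y‖) (‖x‖⁻¹ • innerSL ℝ x) x := by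
  have h1 : HasFDerivAt (fun y : Euc3 => ‖y‖ ^ 2) (2 • innerSL ℝ x) x :=
    (hasStrictFDerivAt_norm_sq x).hasFDerivAt
  have hx' : ‖x‖ ≠ 0 := norm_ne_zero_iff.2 hx
  have h2 := h1.sqrt (by positivity)
  simp only [Real.sqrt_sq (norm_nonneg _)] at h2
  refine h2.congr_fderiv ?_
  ext v
  simp
  field_simp

lemma homU_hasFDerivAt {p : ℝ} {ψ ψ1 : ℝ → ℝ} {x : Euc3} (hx : x ≠ 0)
    (h : HasDerivAt ψ (ψ1 (x 2 / ‖x‖)) (x 2 / ‖x‖)) :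
    HasFDerivAt (homU p ψ) (homL p ψ ψ1 x) x := by
  have hr : 0 < ‖x‖ := norm_pos_iff.2 hx
  have hn := norm_hasFDerivAt hx
  have hp := hn.rpow_const (p := p) (Or.inl hr.ne')
  have hc : HasFDerivAt (fun y : Euc3 => y 2) (EuclideanSpace.proj 2 : Euc3 →L[ℝ] ℝ) x :=
    (EuclideanSpace.proj 2 : Euc3 →L[ℝ] ℝ).hasFDerivAt
  have hinv := (hasDerivAt_inv hr.ne').comp_hasFDerivAt x hn
  have hz := hc.mul hinv
  have hz' : HasFDerivAt (fun y : Euc3 => y 2 / ‖y‖) _ x := hz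
  have hψ := h.comp_hasFDerivAt x hz'
  have hm := hp.mul hψ
  refine HasFDerivAt.congr_fderiv (f := homU p ψ) hm ?_
  have e1 : ‖x‖ ^ p = ‖x‖ ^ 2 * ‖x‖ ^ (p - 2) := by
    rw [← Real.rpow_natCast, ← Real.rpow_add hr]; congr 1; push_cast; ring
  have e2 : ‖x‖ ^ (p - 1) = ‖x‖ * ‖x‖ ^ (p - 2) := by
    nth_rewrite 2 [← Real.rpow_one ‖x‖]
    rw [← Real.rpow_add hr]; congr 1; ring
  ext v
  simp [homL, homU]
  rw [e1, e2]
  field_simp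
  ring

lemma homU_nhds {x : Euc3} (hx : x ≠ 0) (hz : x 2 / ‖x‖ ∈ Ioo (-1:ℝ) 3) :
    ∀ᶠ y in nhds x, y ≠ 0 ∧ y 2 / ‖y‖ ∈ Ioo (-1:ℝ) 3 := by
  have hr : ‖x‖ ≠ 0 := norm_ne_zero_iff.2 hx
  have hc : ContinuousAt (fun y : Euc3 => y 2 / ‖y‖) x := by
    have : Continuous (fun y : Euc3 => y 2) := (EuclideanSpace.proj 2 : Euc3 →L[ℝ] ℝ).continuous
    exact this.continuousAt.div continuous_norm.continuousAt hr
  exact (isOpen_ne.eventually_mem hx).and (hc.eventually (isOpen_Ioo.eventually_mem hz))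

lemma homU_lap {p : ℝ} {ψ ψ1 ψ2 : ℝ → ℝ}
    (h1 : ∀ z ∈ Ioo (-1:ℝ) 3, HasDerivAt ψ (ψ1 z) z)
    (h2 : ∀ z ∈ Ioo (-1:ℝ) 3, HasDerivAt ψ1 (ψ2 z) z)
    (hode : ∀ z ∈ Ioo (-1:ℝ) 3, (1 - z ^ 2) * ψ2 z - 2 * z * ψ1 z + p * (p + 1) * ψ z = 0)
    {x : Euc3} (hx : x ≠ 0) (hz : x 2 / ‖x‖ ∈ Ioo (-1:ℝ) 3) : lap3 (homU p ψ) x = 0 := by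
  have hr : 0 < ‖x‖ := norm_pos_iff.2 hx
  set Φ : ℝ → ℝ := fun z => p * ψ z - z * ψ1 z with hΦ
  set Φ1 : ℝ → ℝ := fun z => p * ψ1 z - (ψ1 z + z * ψ2 z) with hΦ1
  have hΦd : ∀ z ∈ Ioo (-1:ℝ) 3, HasDerivAt Φ (Φ1 z) z := by
    intro z hz
    have := ((h1 z hz).const_mul p).sub ((hasDerivAt_id z).mul (h2 z hz))
    simpa [hΦ, hΦ1] using! this
  have hpd : ∀ i : Fin 3, pd3 i (homU p ψ) =ᶠ[nhds x] fun y =>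
      y i * homU (p - 2) Φ y + (if i = 2 then 1 else 0) * homU (p - 1) ψ1 y := by
    intro i
    filter_upwards [homU_nhds hx hz] with y hy
    unfold pd3
    rw [(homU_hasFDerivAt (p := p) hy.1 (h1 _ hy.2)).fderiv]
    simp only [homL, ← hΦ]
    fin_cases i <;> simp [EuclideanSpace.inner_single_right] <;> ring
  have hd2 : ∀ i : Fin 3, pd3₂ i i (homU p ψ) x =
      homU (p - 2) Φ x + x i * (homL (p - 2) Φ Φ1 x (EuclideanSpace.single i 1))
        + (if i = 2 then 1 else 0) * homL (p - 1) ψ1 ψ2 x (EuclideanSpace.single i 1) := by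
    intro i
    unfold pd3₂
    rw [pd3, (hpd i).fderiv_eq]
    have hc : HasFDerivAt (fun y : Euc3 => y i) (EuclideanSpace.proj i : Euc3 →L[ℝ] ℝ) x :=
      (EuclideanSpace.proj i : Euc3 →L[ℝ] ℝ).hasFDerivAt
    have := (hc.mul (homU_hasFDerivAt (p := p - 2) hx (hΦd _ hz))).add
      ((homU_hasFDerivAt (p := p - 1) hx (h2 _ hz)).const_mul (if i = 2 then (1:ℝ) else 0))
    have e := HasFDerivAt.fderiv (f := fun y : Euc3 => y i * homU (p - 2) Φ y
      + (if i = 2 then 1 else 0) * homU (p - 1) ψ1 y) this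
    rw [e]
    split_ifs <;> simp <;> ring
  unfold lap3
  rw [Fin.sum_univ_three, hd2, hd2, hd2]
  have hn : ‖x‖ ^ 2 = x 0 ^ 2 + x 1 ^ 2 + x 2 ^ 2 := by
    rw [EuclideanSpace.norm_sq_eq, Fin.sum_univ_three]; simp
  set z := x 2 / ‖x‖ with hzdef
  have hx2 : x 2 = z * ‖x‖ := by rw [hzdef]; field_simp
  have hode := hode z hz
  set ρ := ‖x‖ ^ (p - 2 - 2) with hρ
  have e1 : ‖x‖ ^ (p - 2) = ‖x‖ ^ 2 * ρ := by
    rw [hρ, ← Real.rpow_natCast, ← Real.rpow_add hr]; congr 1; push_cast; ring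
  have e2 : ‖x‖ ^ (p - 2 - 1) = ‖x‖ * ρ := by
    nth_rewrite 2 [← Real.rpow_one ‖x‖]
    rw [hρ, ← Real.rpow_add hr]; congr 1; ring
  have e3 : ‖x‖ ^ (p - 1 - 2) = ‖x‖ * ρ := by rw [← e2]; congr 1; ring
  have e4 : ‖x‖ ^ (p - 1 - 1) = ‖x‖ ^ 2 * ρ := by rw [← e1]; congr 1; ring
  have e5 : x 0 ^ 2 + x 1 ^ 2 = ‖x‖ ^ 2 - z ^ 2 * ‖x‖ ^ 2 := by
    rw [← mul_pow, ← hx2, hn]; ring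
  simp [homL, homU, ← hzdef, e1, e2, e3, e4, hΦ, hΦ1, EuclideanSpace.inner_single_right]
  rw [hx2]
  linear_combination (‖x‖ ^ 2 * ρ) * hode + ρ * ((p - 2) * (p * ψ z - z * ψ1 z) - z * (p * ψ1 z - (ψ1 z + z * ψ2 z))) * e5

/-! ### Hölder continuity -/

lemma abs_coord_le (x : Euc3) : |x 2| ≤ ‖x‖ := by
  simpa using PiLp.norm_apply_le x 2

lemma abs_rpow_sub_le {α a b : ℝ} (h0 : 0 < α) (h1 : α < 1) (ha : 0 ≤ a) (hb : 0 ≤ b) :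
    |a ^ α - b ^ α| ≤ |a - b| ^ α := by
  wlog hab : b ≤ a generalizing a b
  · rw [abs_sub_comm, abs_sub_comm a b]
    exact this hb ha (le_of_not_ge hab)
  have := Real.rpow_add_le_add_rpow (sub_nonneg.2 hab) hb h0.le h1.le
  rw [sub_add_cancel] at this
  rw [abs_of_nonneg (sub_nonneg.2 hab), abs_of_nonneg]
  · linarith
  · have := Real.rpow_le_rpow hb hab h0.le
    linarith

lemma homU_holder {α c M L : ℝ} {ψ : ℝ → ℝ} (h0 : 0 < α) (h1 : α < 1) (hc : c < 0)
    (hM : ∀ z ∈ Icc c 1, |ψ z| ≤ M)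
    (hL0 : 0 ≤ L)
    (hL : ∀ z ∈ Icc c 1, ∀ z' ∈ Icc c 1, |ψ z - ψ z'| ≤ L * |z - z'|)
    {x y : Euc3} (hx : c * ‖x‖ ≤ x 2) (hy : c * ‖y‖ ≤ y 2) :
    |homU α ψ x - homU α ψ y| ≤ (M + 2 * L) * ‖x - y‖ ^ α := by
  have hz : ∀ v : Euc3, c * ‖v‖ ≤ v 2 → v 2 / ‖v‖ ∈ Icc c 1 := by
    intro v hv
    rcases eq_or_ne v 0 with rfl | hv0
    · simp [hc.le]
    · have hr : 0 < ‖v‖ := norm_pos_iff.2 hv0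
      refine ⟨(le_div_iff₀ hr).2 hv, (div_le_one hr).2 ((le_abs_self _).trans (abs_coord_le v))⟩
  have hzx := hz x hx
  have hzy := hz y hy
  have hM0 : 0 ≤ M := (abs_nonneg _).trans (hM _ hzx)
  have hd : 0 ≤ ‖x - y‖ ^ α := Real.rpow_nonneg (norm_nonneg _) _
  have t1 : |(‖x‖ ^ α - ‖y‖ ^ α) * ψ (x 2 / ‖x‖)| ≤ M * ‖x - y‖ ^ α := by
    rw [abs_mul, mul_comm]
    have e1 := abs_rpow_sub_le h0 h1 (norm_nonneg x) (norm_nonneg y)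
    have e2 : |‖x‖ - ‖y‖| ^ α ≤ ‖x - y‖ ^ α :=
      Real.rpow_le_rpow (abs_nonneg _) (abs_norm_sub_norm_le x y) h0.le
    exact mul_le_mul (hM _ hzx) (e1.trans e2) (abs_nonneg _) hM0
  have t2 : |‖y‖ ^ α * (ψ (x 2 / ‖x‖) - ψ (y 2 / ‖y‖))| ≤ 2 * L * ‖x - y‖ ^ α := by
    rcases eq_or_ne y 0 with rfl | hy0
    · rw [norm_zero, Real.zero_rpow h0.ne', zero_mul, abs_zero]; positivity
    rcases eq_or_ne x 0 with rfl | hx0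
    · -- the vertex
      have hr : 0 < ‖y‖ := norm_pos_iff.2 hy0
      rw [abs_mul, abs_of_nonneg (Real.rpow_nonneg hr.le _), zero_sub, norm_neg, mul_comm]
      gcongr
      refine (hL _ hzx _ hzy).trans ?_
      rw [mul_comm]
      gcongr
      have : |y 2 / ‖y‖| ≤ 1 := by
        rw [abs_div, abs_norm, div_le_one hr]; exact abs_coord_le y
      simp only [PiLp.zero_apply, zero_div, zero_sub, abs_neg]
      linarith
    have hrx : 0 < ‖x‖ := norm_pos_iff.2 hx0
    have hry : 0 < ‖y‖ := norm_pos_iff.2 hy0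
    set d := |x 2 / ‖x‖ - y 2 / ‖y‖| with hdd
    have hzx1 : |x 2 / ‖x‖| ≤ 1 := by
      rw [abs_div, abs_norm, div_le_one hrx]; exact abs_coord_le x
    have hzy1 : |y 2 / ‖y‖| ≤ 1 := by
      rw [abs_div, abs_norm, div_le_one hry]; exact abs_coord_le y
    have hd0 : 0 ≤ d := abs_nonneg _
    have hd2 : d ≤ 2 := (abs_sub _ _).trans (by linarith)
    have hd3 : ‖y‖ * d ≤ 2 * ‖x - y‖ := by
      have e : ‖y‖ * (x 2 / ‖x‖ - y 2 / ‖y‖) =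
          (x 2 / ‖x‖) * (‖y‖ - ‖x‖) + (x - y) 2 := by
        simp only [PiLp.sub_apply]
        field_simp
        ring
      have : ‖y‖ * d = |(x 2 / ‖x‖) * (‖y‖ - ‖x‖) + (x - y) 2| := by
        rw [← e, abs_mul, abs_norm]
      rw [this]
      have a1 := abs_add_le ((x 2 / ‖x‖) * (‖y‖ - ‖x‖)) ((x - y) 2)
      have a2 := abs_coord_le (x - y)
      have a3 : |(x 2 / ‖x‖) * (‖y‖ - ‖x‖)| ≤ 1 * ‖x - y‖ := by
        rw [abs_mul, abs_sub_comm]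
        exact mul_le_mul hzx1 (abs_norm_sub_norm_le x y) (abs_nonneg _) zero_le_one
      linarith
    have hd4 : ‖y‖ ^ α * d ≤ 2 * ‖x - y‖ ^ α := by
      have s1 : d = d ^ α * d ^ (1 - α) := by
        rcases hd0.eq_or_lt with h | h
        · rw [← h, Real.zero_rpow h0.ne', zero_mul]
        · rw [← Real.rpow_add h]; simp
      have s2 : d ^ (1 - α) ≤ 2 ^ (1 - α) := Real.rpow_le_rpow hd0 hd2 (by linarith)
      have s3 : (‖y‖ * d) ^ α ≤ (2 * ‖x - y‖) ^ α :=
        Real.rpow_le_rpow (by positivity) hd3 h0.le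
      rw [Real.mul_rpow hry.le hd0, Real.mul_rpow (by norm_num) (norm_nonneg _)] at s3
      calc ‖y‖ ^ α * d = (‖y‖ ^ α * d ^ α) * d ^ (1 - α) := by
            conv_lhs => rw [s1]
            ring
        _ ≤ (2 ^ α * ‖x - y‖ ^ α) * 2 ^ (1 - α) := by
            apply mul_le_mul s3 s2 <;> positivity
        _ = (2 ^ α * 2 ^ (1 - α)) * ‖x - y‖ ^ α := by ring
        _ = 2 * ‖x - y‖ ^ α := by
            rw [← Real.rpow_add (by norm_num)]; norm_num
    rw [abs_mul, abs_of_nonneg (Real.rpow_nonneg hry.le _)]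
    calc ‖y‖ ^ α * |ψ (x 2 / ‖x‖) - ψ (y 2 / ‖y‖)| ≤ ‖y‖ ^ α * (L * d) := by
          gcongr; exact hL _ hzx _ hzy
      _ = L * (‖y‖ ^ α * d) := by ring
      _ ≤ L * (2 * ‖x - y‖ ^ α) := by gcongr
      _ = _ := by ring
  have e : homU α ψ x - homU α ψ y = (‖x‖ ^ α - ‖y‖ ^ α) * ψ (x 2 / ‖x‖)
      + ‖y‖ ^ α * (ψ (x 2 / ‖x‖) - ψ (y 2 / ‖y‖)) := by unfold homU; ring
  rw [e]
  refine (abs_add_le _ _).trans ?_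
  linarith

/-! ### Geometry of the cone -/

lemma mem_cone3_iff {θ₀ : ℝ} (h0 : 0 < θ₀) (h1 : θ₀ < π) (hc : cos θ₀ < 0) (x : Euc3) :
    x ∈ cone3 θ₀ ↔ cos θ₀ * ‖x‖ < x 2 := by
  have key : ∀ hr : 0 < ‖x‖, (polarAngle3 x < θ₀ ↔ cos θ₀ * ‖x‖ < x 2) := by
    intro hr
    have hb : |x 2 / ‖x‖| ≤ 1 := by
      rw [abs_div, abs_norm, div_le_one hr]; exact abs_coord_le x
    have hb := abs_le.1 hb
    unfold polarAngle3
    rw [← lt_div_iff₀ hr]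
    conv_rhs => rw [← Real.cos_arccos hb.1 hb.2]
    exact (Real.strictAntiOn_cos.lt_iff_gt ⟨h0.le, h1.le⟩
      ⟨Real.arccos_nonneg _, Real.arccos_le_pi _⟩).symm
  constructor
  · rintro ⟨hr, h⟩
    exact (key hr).1 h
  · intro h
    have hr : 0 < ‖x‖ := by
      rw [norm_pos_iff]
      rintro rfl
      simp at h
    exact ⟨hr, (key hr).2 h⟩

lemma closure_cone3 {θ₀ : ℝ} (h0 : 0 < θ₀) (h1 : θ₀ < π) (hc : cos θ₀ < 0) {x : Euc3}
    (hx : x ∈ closure (cone3 θ₀)) : cos θ₀ * ‖x‖ ≤ x 2 := by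
  have hcl : IsClosed {x : Euc3 | cos θ₀ * ‖x‖ ≤ x 2} := by
    have : Continuous (fun y : Euc3 => y 2) := (EuclideanSpace.proj 2 : Euc3 →L[ℝ] ℝ).continuous
    exact isClosed_le (by fun_prop) this
  exact closure_minimal (fun y hy => ((mem_cone3_iff h0 h1 hc y).1 hy).le) hcl hx

lemma uniqueDiff_cone3 {θ₀ : ℝ} (h0 : 0 < θ₀) (h1 : θ₀ < π) (hc : cos θ₀ < 0)
    (hc1 : -1 < cos θ₀) {x : Euc3} (hx : cos θ₀ * ‖x‖ ≤ x 2) :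
    UniqueDiffWithinAt ℝ (closure (cone3 θ₀)) x := by
  set c := cos θ₀ with hcd
  have hc2 : Continuous (fun y : Euc3 => y 2) := (EuclideanSpace.proj 2 : Euc3 →L[ℝ] ℝ).continuous
  set K : Set Euc3 := {y | -c * ‖y - x‖ < (y - x) 2} with hK
  have hopen : IsOpen K := by
    refine isOpen_lt (by fun_prop) ?_
    exact hc2.comp (by fun_prop : Continuous fun y : Euc3 => y - x)
  have hpt : ∀ t : ℝ, 0 < t → x + t • EuclideanSpace.single (2 : Fin 3) (1:ℝ) ∈ K := by
    intro t ht
    simp [hK, norm_smul, abs_of_pos ht]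
    nlinarith
  have hconv : Convex ℝ K := by
    intro y hy z hz a b ha hb hab
    simp only [hK, mem_setOf_eq] at hy hz ⊢
    have e : a • y + b • z - x = a • (y - x) + b • (z - x) := by
      have : x = (a + b) • x := by rw [hab, one_smul]
      conv_lhs => rw [this]
      module
    rw [e]
    have n1 : ‖a • (y - x) + b • (z - x)‖ ≤ a * ‖y - x‖ + b * ‖z - x‖ := by
      refine (norm_add_le _ _).trans ?_
      rw [norm_smul, norm_smul, Real.norm_of_nonneg ha, Real.norm_of_nonneg hb]
    have n2 : (a • (y - x) + b • (z - x)) 2 = a * (y - x) 2 + b * (z - x) 2 := by simp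
    rw [n2]
    have n3 := mul_le_mul_of_nonneg_left n1 (by linarith : 0 ≤ -c)
    rcases ha.eq_or_lt with h | h
    · subst h
      have : b = 1 := by linarith
      subst this
      nlinarith
    · nlinarith
  have hsub : K ⊆ closure (cone3 θ₀) := by
    intro y hy
    apply subset_closure
    rw [mem_cone3_iff h0 h1 hc]
    simp only [hK, mem_setOf_eq, PiLp.sub_apply] at hy
    have : ‖x‖ ≤ ‖y‖ + ‖y - x‖ := by
      have := norm_sub_le y (y - x)
      simpa using this
    nlinarith
  have hxK : x ∈ closure K := by
    have ht : Filter.Tendsto (fun t : ℝ => x + t • EuclideanSpace.single (2 : Fin 3) (1:ℝ))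
        (nhdsWithin 0 (Ioi 0)) (nhds x) := by
      have : Continuous (fun t : ℝ => x + t • EuclideanSpace.single (2 : Fin 3) (1:ℝ)) := by
        fun_prop
      have := (this.tendsto 0).mono_left (nhdsWithin_le_nhds (s := Ioi 0))
      simpa using this
    refine mem_closure_of_tendsto ht ?_
    filter_upwards [self_mem_nhdsWithin] with t ht using hpt t ht
  have hne : (interior K).Nonempty := by
    rw [hopen.interior_eq]; exact ⟨_, hpt 1 one_pos⟩
  exact (uniqueDiffWithinAt_convex hconv hne hxK).mono hsub

/-! ### The counterexample -/

lemma psi_hasDerivAt {a : ℕ → ℝ} (h : psAdm a) (k : ℝ) {z : ℝ} (hz : z ∈ Ioo (-1:ℝ) 3) :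
    HasDerivAt (fun z => k * psS a ((1 - z) / 2)) (-k / 2 * psS (psD a) ((1 - z) / 2)) z := by
  have hw : |(1 - z) / 2| < 1 := by
    rw [abs_lt]; constructor <;> linarith [hz.1, hz.2]
  have h1 : HasDerivAt (fun z : ℝ => (1 - z) / 2) (-1 / 2) z :=
    ((hasDerivAt_id z).const_sub 1).div_const 2
  have h2 : HasDerivAt (fun z => psS a ((1 - z) / 2)) (psS (psD a) ((1 - z) / 2) * (-1 / 2)) z :=
    HasDerivAt.comp (h₂ := psS a) z (ps_hasDerivAt h hw) h1
  refine (h2.const_mul k).congr_deriv ?_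
  ring

lemma props_of {θ₀ s α : ℝ} {ψ ψ1 ψ2 : ℝ → ℝ} (h0 : 0 < θ₀) (h1 : θ₀ < π) (hc : cos θ₀ < 0)
    (hα : α ∈ Ioo (0:ℝ) 1)
    (hd1 : ∀ z ∈ Ioo (-1:ℝ) 3, HasDerivAt ψ (ψ1 z) z)
    (hd2 : ∀ z ∈ Ioo (-1:ℝ) 3, HasDerivAt ψ1 (ψ2 z) z)
    (hode : ∀ z ∈ Ioo (-1:ℝ) 3, (1 - z ^ 2) * ψ2 z - 2 * z * ψ1 z + α * (α + 1) * ψ z = 0)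
    (hsm : ContDiffOn ℝ (⊤ : ℕ∞) ψ (Ioo (-1:ℝ) 3))
    (hone : ψ 1 = 1)
    (hbc : α * ψ (cos θ₀) * cos (θ₀ - s) + ψ1 (cos θ₀) * sin θ₀ * sin (θ₀ - s) = 0) :
    counterexampleProps θ₀ s α (homU α ψ) := by
  obtain ⟨ha0, ha1⟩ := hα
  have hc1 : -1 < cos θ₀ := by
    have := Real.cos_lt_cos_of_nonneg_of_le_pi h0.le le_rfl h1
    simpa using this
  have hcl : ∀ x ∈ closure (cone3 θ₀), cos θ₀ * ‖x‖ ≤ x 2 := fun x hx => closure_cone3 h0 h1 hc hx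
  have hzmem : ∀ x : Euc3, x ≠ 0 → cos θ₀ * ‖x‖ ≤ x 2 → x 2 / ‖x‖ ∈ Ioo (-1:ℝ) 3 := by
    intro x hx hxc
    have hr : 0 < ‖x‖ := norm_pos_iff.2 hx
    have e1 := (le_div_iff₀ hr).2 hxc
    have e2 := (div_le_one hr).2 ((le_abs_self _).trans (abs_coord_le x))
    exact ⟨by linarith, by linarith⟩
  have hfd : ∀ x : Euc3, x ≠ 0 → cos θ₀ * ‖x‖ ≤ x 2 →
      fderivWithin ℝ (homU α ψ) (closure (cone3 θ₀)) x = homL α ψ ψ1 x := by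
    intro x hx hxc
    exact (homU_hasFDerivAt hx (hd1 _ (hzmem x hx hxc))).hasFDerivWithinAt.fderivWithin
      (uniqueDiff_cone3 h0 h1 hc hc1 hxc)
  have hsub : Icc (cos θ₀) 1 ⊆ Ioo (-1:ℝ) 3 := fun z hz => ⟨by linarith [hz.1], by linarith [hz.2]⟩
  obtain ⟨M, hM⟩ := (isCompact_Icc (a := cos θ₀) (b := 1)).exists_bound_of_continuousOn
    (f := ψ) (fun z hz => (hd1 z (hsub hz)).continuousAt.continuousWithinAt)
  obtain ⟨L, hL⟩ := (isCompact_Icc (a := cos θ₀) (b := 1)).exists_bound_of_continuousOn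
    (f := ψ1) (fun z hz => (hd2 z (hsub hz)).continuousAt.continuousWithinAt)
  have h1mem : (1:ℝ) ∈ Icc (cos θ₀) 1 := ⟨Real.cos_le_one _, le_rfl⟩
  have hM0 : 0 ≤ M := (norm_nonneg _).trans (hM 1 h1mem)
  have hL0 : 0 ≤ L := (norm_nonneg _).trans (hL 1 h1mem)
  have hLip : ∀ z ∈ Icc (cos θ₀) 1, ∀ z' ∈ Icc (cos θ₀) 1, |ψ z - ψ z'| ≤ L * |z - z'| := by
    intro z hz z' hz'
    exact (convex_Icc (cos θ₀) 1).norm_image_sub_le_of_norm_hasDerivWithin_le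
      (fun y hy => (hd1 y (hsub hy)).hasDerivWithinAt) hL hz' hz
  have hHol : HolderOnWith (M + 2 * L).toNNReal α.toNNReal (homU α ψ) (closure (cone3 θ₀)) := by
    intro x hx y hy
    have key := homU_holder ha0 ha1 hc hM hL0 hLip (hcl x hx) (hcl y hy)
    rw [edist_dist, edist_dist, Real.dist_eq, dist_eq_norm, Real.coe_toNNReal _ ha0.le,
      ENNReal.ofReal_rpow_of_nonneg (norm_nonneg _) ha0.le]
    have : ((M + 2 * L).toNNReal : ENNReal) = ENNReal.ofReal (M + 2 * L) := rfl
    rw [this, ← ENNReal.ofReal_mul (by positivity)]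
    exact ENNReal.ofReal_le_ofReal key
  set e3 : Euc3 := EuclideanSpace.single (2 : Fin 3) (1:ℝ) with he3
  have hn3 : ∀ t : ℝ, 0 < t → ‖t • e3‖ = t := by
    intro t ht
    simp [he3, norm_smul, abs_of_pos ht]
  have hc3 : ∀ t : ℝ, (t • e3) 2 = t := by
    intro t
    simp [he3]
  have hmem : ∀ t : ℝ, 0 < t → t • e3 ∈ cone3 θ₀ := by
    intro t ht
    rw [mem_cone3_iff h0 h1 hc, hn3 t ht, hc3]
    nlinarith
  have hne : ∀ t : ℝ, 0 < t → t • e3 ≠ 0 := by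
    intro t ht h
    have := hn3 t ht
    rw [h, norm_zero] at this
    linarith
  have hval : ∀ t : ℝ, 0 < t → homU α ψ (t • e3) = t ^ α := by
    intro t ht
    rw [homU, hn3 t ht, hc3, div_self ht.ne', hone, mul_one]
  have hz0 : homU α ψ 0 = 0 := by
    rw [homU, norm_zero, Real.zero_rpow ha0.ne', zero_mul]
  have htend : Filter.Tendsto (fun t : ℝ => t • e3) (nhdsWithin 0 (Ioi 0))
      (nhdsWithin 0 (cone3 θ₀)) := by
    rw [tendsto_nhdsWithin_iff]
    constructor
    · have : Continuous (fun t : ℝ => t • e3) := by fun_prop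
      have := (this.tendsto 0).mono_left (nhdsWithin_le_nhds (s := Ioi 0))
      simpa using this
    · filter_upwards [self_mem_nhdsWithin] with t ht using hmem t ht
  have h0cl : (0 : Euc3) ∈ closure (cone3 θ₀) := by
    rw [mem_closure_iff_nhdsWithin_neBot]
    exact htend.neBot
  refine ⟨hHol.continuousOn (Real.toNNReal_pos.2 ha0), ?_, ?_, ?_, ?_, ?_, ?_, ?_, ?_, ?_⟩
  · rintro x ⟨hx, hx0⟩
    have hx0 : x ≠ 0 := hx0
    have hr : ‖x‖ ≠ 0 := norm_ne_zero_iff.2 hx0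
    have hz := hzmem x hx0 (hcl x hx)
    have hn : ContDiffAt ℝ (⊤ : ℕ∞) (fun y : Euc3 => ‖y‖) x := contDiffAt_norm ℝ hx0
    have hp : ContDiffAt ℝ (⊤ : ℕ∞) (fun y : Euc3 => y 2) x :=
      (EuclideanSpace.proj 2 : Euc3 →L[ℝ] ℝ).contDiff.contDiffAt
    have hq : ContDiffAt ℝ (⊤ : ℕ∞) (fun y : Euc3 => y 2 / ‖y‖) x := hp.div hn hr
    have hψ : ContDiffAt ℝ (⊤ : ℕ∞) ψ (x 2 / ‖x‖) := hsm.contDiffAt (isOpen_Ioo.mem_nhds hz)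
    exact ((hn.rpow_const_of_ne hr).mul (hψ.comp x hq)).contDiffWithinAt
  · intro x x' h2 h01
    have : ‖x‖ = ‖x'‖ := by
      rw [EuclideanSpace.norm_eq, EuclideanSpace.norm_eq, Fin.sum_univ_three, Fin.sum_univ_three]
      simp only [Real.norm_eq_abs, sq_abs]
      rw [h01, h2]
    simp only [homU, this, h2]
  · intro l hl x _
    simp only [homU, norm_smul, Real.norm_of_nonneg hl.le, PiLp.smul_apply, smul_eq_mul]
    rw [Real.mul_rpow hl.le (norm_nonneg _), mul_div_mul_left _ _ hl.ne', mul_assoc]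
  · refine ⟨(1:ℝ) • e3, subset_closure (hmem 1 one_pos), ?_⟩
    rw [hval 1 one_pos]; simp
  · intro x hx
    have hx0 : x ≠ 0 := norm_pos_iff.1 hx.1
    exact homU_lap hd1 hd2 hode hx0 (hzmem x hx0 (hcl x (subset_closure hx)))
  · rintro x ⟨hr, hx⟩
    have hx0 : x ≠ 0 := norm_pos_iff.1 hr
    have hz : x 2 / ‖x‖ = cos θ₀ := by
      have hb : |x 2 / ‖x‖| ≤ 1 := by
        rw [abs_div, abs_norm, div_le_one hr]; exact abs_coord_le x
      have hb := abs_le.1 hb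
      rw [← hx, polarAngle3, Real.cos_arccos hb.1 hb.2]
    have hx2 : x 2 = ‖x‖ * cos θ₀ := by rw [← hz]; field_simp
    rw [hfd x hx0 (by rw [hx2, mul_comm])]
    have hsin : 0 < sin θ₀ := Real.sin_pos_of_pos_of_lt_pi h0 h1
    have hn : ‖x‖ ^ 2 = x 0 ^ 2 + x 1 ^ 2 + x 2 ^ 2 := by
      rw [EuclideanSpace.norm_sq_eq, Fin.sum_univ_three]; simp
    have h01 : x 0 ^ 2 + x 1 ^ 2 = (‖x‖ * sin θ₀) ^ 2 := by
      have := Real.sin_sq_add_cos_sq θ₀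
      rw [hx2] at hn
      linear_combination -hn - ‖x‖ ^ 2 * this
    have hsq : Real.sqrt (x 0 ^ 2 + x 1 ^ 2) = ‖x‖ * sin θ₀ := by
      rw [h01, Real.sqrt_sq (by positivity)]
    have hin : inner ℝ x (obliqueVec3 s x) = ‖x‖ * cos (θ₀ - s) := by
      rw [PiLp.inner_apply, Fin.sum_univ_three]
      simp [obliqueVec3]
      rw [hsq, cos_sub, hx2]
      field_simp
      linear_combination sin s * h01
    have hb2 : (EuclideanSpace.proj 2 : Euc3 →L[ℝ] ℝ) (obliqueVec3 s x) = cos s := by simp [obliqueVec3]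
    have e2 : ‖x‖ ^ (α - 1) = ‖x‖ * ‖x‖ ^ (α - 2) := by
      nth_rewrite 2 [← Real.rpow_one ‖x‖]
      rw [← Real.rpow_add hr]; congr 1; ring
    have e3 : cos s = cos θ₀ * cos (θ₀ - s) + sin θ₀ * sin (θ₀ - s) := by
      rw [← cos_sub]; congr 1; ring
    simp only [homL, homU, hz, add_apply, smul_apply,
      innerSL_apply_apply, smul_eq_mul, hin, hb2]
    rw [e2, e3]
    linear_combination (‖x‖ * ‖x‖ ^ (α - 2)) * hbc
  · exact ⟨_, hHol.mono inter_subset_left⟩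
  · intro ε hε K δ hδ hcon
    have hev : ∀ᶠ t : ℝ in nhdsWithin 0 (Ioi 0), 1 ≤ (K:ℝ) * t ^ ε := by
      have hlt : ∀ᶠ t : ℝ in nhdsWithin 0 (Ioi 0), t < δ :=
        nhdsWithin_le_nhds (Iio_mem_nhds hδ)
      filter_upwards [self_mem_nhdsWithin, hlt] with t ht htd
      have ht : 0 < t := ht
      have hh := hcon (t • e3) ⟨subset_closure (hmem t ht), by
        rw [mem_ball_zero_iff, hn3 t ht]; exact htd⟩ 0 ⟨h0cl, Metric.mem_ball_self hδ⟩
      rw [edist_dist, edist_dist, Real.dist_eq, dist_eq_norm, Real.coe_toNNReal _ (by positivity),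
        ENNReal.ofReal_rpow_of_nonneg (norm_nonneg _) (by positivity), hval t ht, hz0, sub_zero,
        sub_zero, hn3 t ht, ← ENNReal.ofReal_coe_nnreal, ← ENNReal.ofReal_mul (by positivity),
        ENNReal.ofReal_le_ofReal_iff (by positivity), Real.rpow_add ht,
        abs_of_nonneg (by positivity)] at hh
      have hp : 0 < t ^ α := Real.rpow_pos_of_pos ht α
      by_contra hlt
      push Not at hlt
      nlinarith
    have hlim : Filter.Tendsto (fun t : ℝ => (K:ℝ) * t ^ ε) (nhdsWithin 0 (Ioi 0)) (nhds 0) := by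
      have hcc : Continuous (fun t : ℝ => (K:ℝ) * t ^ ε) :=
        continuous_const.mul (Real.continuous_rpow_const hε.le)
      have := (hcc.tendsto 0).mono_left (nhdsWithin_le_nhds (s := Ioi 0))
      simpa [Real.zero_rpow hε.ne'] using this
    have := ge_of_tendsto hlim hev
    linarith
  · rintro ⟨G, hG, hGe⟩
    have ht0 : Filter.Tendsto (fun t : ℝ => G (t • e3) e3) (nhdsWithin 0 (Ioi 0))
        (nhds (G 0 e3)) := by
      have a := (hG 0 h0cl).tendsto.comp (htend.mono_right (nhdsWithin_mono 0 subset_closure))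
      exact ((ContinuousLinearMap.apply ℝ ℝ e3).continuous.tendsto (G 0)).comp a
    have hev : (fun t : ℝ => G (t • e3) e3) =ᶠ[nhdsWithin 0 (Ioi 0)]
        fun t => α * t ^ (α - 1) := by
      filter_upwards [self_mem_nhdsWithin] with t ht
      have ht : 0 < t := ht
      rw [hGe _ ⟨subset_closure (hmem t ht), hne t ht⟩,
        hfd _ (hne t ht) (hcl _ (subset_closure (hmem t ht)))]
      have e2 : t ^ (α - 1) = t * t ^ (α - 2) := by
        nth_rewrite 2 [← Real.rpow_one t]
        rw [← Real.rpow_add ht]; congr 1; ring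
      have i1 : inner ℝ (t • e3) e3 = t := by
        simp [he3, EuclideanSpace.inner_single_right]
      have i2 : (EuclideanSpace.proj 2 : Euc3 →L[ℝ] ℝ) e3 = 1 := by simp [he3]
      simp only [homL, homU, hn3 t ht, hc3, div_self ht.ne', add_apply,
        smul_apply, innerSL_apply_apply, smul_eq_mul,
        i1, i2, hone]
      rw [e2]
      ring
    have ht1 := ht0.congr' hev
    have ht2 : Filter.Tendsto (fun t : ℝ => α * t ^ (α - 1)) (nhdsWithin 0 (Ioi 0))
        Filter.atTop :=
      (tendsto_rpow_neg_nhdsGT_zero (by linarith : α - 1 < 0)).const_mul_atTop ha0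
    exact not_tendsto_nhds_of_tendsto_atTop ht2 _ ht1

theorem counterexample_large_opening_angle
    (θ₀ : ℝ) (hθ₀ : θ₀ ∈ Ioo (π / 2) π) :
    ∃ s₀ ∈ Ioo (-π + θ₀) 0,
      ∀ s : ℝ, (s ∈ Ioo (-π + θ₀) s₀ ∨ s ∈ Ioo (π / 2) θ₀) →
        ∃ α ∈ Ioo (0 : ℝ) 1, ∃ u : Euc3 → ℝ, counterexampleProps θ₀ s α u := by
  have hpi := Real.pi_pos
  refine ⟨(θ₀ - π) / 2, ⟨by linarith [hθ₀.2], by linarith [hθ₀.2]⟩, ?_⟩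
  intro s hs
  obtain ⟨α, hα, hbc⟩ := exists_alpha hθ₀ hs
  have hadm : psAdm (legA α) := legA_adm ⟨hα.1.le, hα.2.le⟩
  refine ⟨α, hα, homU α (fun z => 1 * psS (legA α) ((1 - z) / 2)), ?_⟩
  refine props_of (ψ1 := fun z => -1 / 2 * psS (psD (legA α)) ((1 - z) / 2))
    (ψ2 := fun z => -(-1 / 2) / 2 * psS (psD (psD (legA α))) ((1 - z) / 2))
    (by linarith [hθ₀.1]) hθ₀.2
    (Real.cos_neg_of_pi_div_two_lt_of_lt hθ₀.1 (by linarith [hθ₀.2])) hα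
    (fun z hz => psi_hasDerivAt hadm 1 hz)
    (fun z hz => psi_hasDerivAt (psAdm_D hadm) (-1 / 2) hz) ?_ ?_ ?_ ?_
  · intro z hz
    have hw : |(1 - z) / 2| < 1 := by
      rw [abs_lt]; constructor <;> linarith [hz.1, hz.2]
    have := ps_ode hadm (legA_rec α) hw
    linear_combination this
  · have h1 : ContDiffOn ℝ (⊤ : ℕ∞) (fun z : ℝ => (1 - z) / 2) (Ioo (-1:ℝ) 3) :=
      ((contDiff_const.sub contDiff_id).div_const 2).contDiffOn
    exact contDiffOn_const.mul ((ps_contDiffOn hadm).comp h1 fun z hz =>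
      ⟨by linarith [hz.2], by linarith [hz.1]⟩)
  · simp only [sub_self, zero_div, one_mul]
    unfold psS
    rw [tsum_eq_single 0]
    · simp [legA]
    · intro n hn; simp [hn]
  · linear_combination hbc
end
end

section
/- Comparison principle, first version (Theorem 5.1, problem (5.1)). Let n ≥ 3 be an integer, a₁, a₂ > 0 constants, and define the operator L₀u = a₁ ∂²u/∂y₁² + a₂ ∂²u/∂y₂² + ((n−2)a₂ / y₂) ∂u/∂y₂ for functions on ω (L₀ is the axi-symmetric reduction of a constant-coefficient elliptic operator on ℝⁿ invariant under rotations about the axis). Let β₀ = (β₁, β₂) be a constant vector with β₀·ν > 0, let ã ∈ ℝ and b̃ > 0 be constants. Suppose u ∈ C²(ω) ∩ C¹(ω̄ ∖ {0}) ∩ C(ω̄) satisfies: L₀u ≤ 0 in ω; ∂u/∂y₂ = 0 on γ_symm; β₀·Du + ã·(τ·Du) − (b̃/y₂)·u ≤ 0 on γ_cone; u ≥ 0 on the closure of γ_ball; and u(0) = 0. Then u ≥ 0 throughout ω̄, i.e. inf_{ω̄} u = 0. -/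
noncomputable section
open Real Set

abbrev Euc2 := EuclideanSpace ℝ (Fin 2)

/-- The vector `(a, b) ∈ ℝ²` as an element of `EuclideanSpace ℝ (Fin 2)`. -/
def vec2 (a b : ℝ) : Euc2 := (WithLp.equiv 2 (Fin 2 → ℝ)).symm ![a, b]

/-- Partial derivative in the `i`-th coordinate direction. -/
def pdy (i : Fin 2) (u : Euc2 → ℝ) (y : Euc2) : ℝ :=
  fderiv ℝ u y (EuclideanSpace.single i 1)

/-- Second partial derivative `∂_i ∂_j u`. -/
def pdy₂ (i j : Fin 2) (u : Euc2 → ℝ) (y : Euc2) : ℝ :=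
  pdy i (pdy j u) y

/-- The polar angle `θ(y) ∈ [0,π]` of `y = (y₁, y₂)`, with `y₁ = |y| cos θ`. -/
def polarAngle2 (y : Euc2) : ℝ := Real.arccos (y 0 / ‖y‖)

/-- The two-dimensional symmetry domain
`ω = {(y₁,y₂) : y₂ ≥ 0, 0 < |y| < R, θ < θ₀}`. -/
def omega2 (R θ₀ : ℝ) : Set Euc2 :=
  {y | 0 ≤ y 1 ∧ 0 < ‖y‖ ∧ ‖y‖ < R ∧ polarAngle2 y < θ₀}

/-- The interior part `{y₂ > 0}` of `ω`, where the operator `L₀` is non-singular. -/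
def omega2O (R θ₀ : ℝ) : Set Euc2 :=
  {y | 0 < y 1 ∧ ‖y‖ < R ∧ polarAngle2 y < θ₀}

/-- `γ_cone = {0 < |y| < R, θ = θ₀}`. -/
def gammaCone2 (R θ₀ : ℝ) : Set Euc2 :=
  {y | 0 ≤ y 1 ∧ 0 < ‖y‖ ∧ ‖y‖ < R ∧ polarAngle2 y = θ₀}

/-- `γ_symm = {0 < |y| < R, θ = 0}`. -/
def gammaSymm2 (R : ℝ) : Set Euc2 :=
  {y | 0 < y 0 ∧ y 0 < R ∧ y 1 = 0}

/-- `γ_ball = {|y| = R, θ ∈ (0,θ₀)}`. -/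
def gammaBall2 (R θ₀ : ℝ) : Set Euc2 :=
  {y | ‖y‖ = R ∧ 0 < y 1 ∧ polarAngle2 y < θ₀}

/-- The operator `L₀u = a₁ u_{y₁y₁} + a₂ u_{y₂y₂} + ((n−2) a₂ / y₂) u_{y₂}`,
the axi-symmetric reduction of a rotationally invariant constant-coefficient
elliptic operator on `ℝⁿ`. -/
def Lop (n : ℕ) (a₁ a₂ : ℝ) (u : Euc2 → ℝ) (y : Euc2) : ℝ :=
  a₁ * pdy₂ 0 0 u y + a₂ * pdy₂ 1 1 u y + ((n : ℝ) - 2) * a₂ / y 1 * pdy 1 u y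

/-- The inward unit normal on `γ_cone`. -/
def nuVec (θ₀ : ℝ) : Euc2 := vec2 (Real.sin θ₀) (-Real.cos θ₀)

/-- The unit tangent on `γ_cone`. -/
def tauVec (θ₀ : ℝ) : Euc2 := vec2 (-Real.cos θ₀) (-Real.sin θ₀)

open Filter Topology

lemma nsq (y : Euc2) : ‖y‖ ^ 2 = y 0 ^ 2 + y 1 ^ 2 := by
  rw [EuclideanSpace.real_norm_sq_eq, Fin.sum_univ_two]

def nuf (θ₀ : ℝ) (y : Euc2) : ℝ := Real.sin θ₀ * y 0 - Real.cos θ₀ * y 1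

lemma nuf_cont (θ₀ : ℝ) : Continuous (nuf θ₀) := by
  unfold nuf; fun_prop

lemma polar_coords (y : Euc2) (h1 : 0 ≤ y 1) (hy : 0 < ‖y‖) :
    y 0 = ‖y‖ * Real.cos (polarAngle2 y) ∧ y 1 = ‖y‖ * Real.sin (polarAngle2 y) := by
  have h := nsq y
  have hle : |y 0 / ‖y‖| ≤ 1 := by
    rw [abs_div, abs_of_pos hy, div_le_one hy]
    exact abs_le_of_sq_le_sq (by nlinarith [sq_nonneg (y 1)]) hy.le
  have hl := abs_le.1 hle
  constructor
  · rw [polarAngle2, Real.cos_arccos hl.1 hl.2]; field_simp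
  · rw [polarAngle2, Real.sin_arccos]
    have : 1 - (y 0 / ‖y‖) ^ 2 = (y 1 / ‖y‖) ^ 2 := by
      field_simp; linarith
    rw [this, Real.sqrt_sq (by positivity)]; field_simp

lemma nuf_eq (θ₀ : ℝ) (y : Euc2) (h1 : 0 ≤ y 1) (hy : 0 < ‖y‖) :
    nuf θ₀ y = ‖y‖ * Real.sin (θ₀ - polarAngle2 y) := by
  obtain ⟨h, h'⟩ := polar_coords y h1 hy
  rw [Real.sin_sub, nuf]
  generalize polarAngle2 y = φ at *
  rw [h, h']
  generalize ‖y‖ = r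
  ring

lemma norm_pos_of (y : Euc2) (h1 : 0 < y 1) : 0 < ‖y‖ := by
  have := nsq y
  by_contra h
  have h0 : ‖y‖ = 0 := le_antisymm (not_lt.1 h) (norm_nonneg _)
  rw [h0] at this
  nlinarith [sq_nonneg (y 0)]

lemma polar_bounds (y : Euc2) (h1 : 0 < y 1) : 0 < polarAngle2 y ∧ polarAngle2 y < π := by
  obtain ⟨h, h'⟩ := polar_coords y h1.le (norm_pos_of y h1)
  have h0 : 0 ≤ polarAngle2 y := Real.arccos_nonneg _
  have hp : polarAngle2 y ≤ π := Real.arccos_le_pi _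
  constructor
  · refine lt_of_le_of_ne h0 fun e => ?_
    rw [← e] at h'; simp at h'; linarith
  · refine lt_of_le_of_ne hp fun e => ?_
    rw [e] at h'; simp at h'; linarith

lemma nuf_pos_iff {θ₀ : ℝ} (hθ₀ : θ₀ ∈ Ioo 0 π) (y : Euc2) (h1 : 0 < y 1) :
    0 < nuf θ₀ y ↔ polarAngle2 y < θ₀ := by
  have hy := norm_pos_of y h1
  rw [nuf_eq _ _ h1.le hy]
  obtain ⟨h, h'⟩ := polar_bounds y h1
  obtain ⟨t0, t1⟩ := hθ₀
  rw [mul_pos_iff_of_pos_left hy]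
  constructor
  · intro hs
    by_contra hc
    have := Real.sin_nonpos_of_nonpos_of_neg_pi_le (x := θ₀ - polarAngle2 y) (by linarith) (by linarith)
    linarith
  · intro hs
    exact Real.sin_pos_of_pos_of_lt_pi (by linarith) (by linarith)

lemma nuf_zero {θ₀ : ℝ} (hθ₀ : θ₀ ∈ Ioo 0 π) (y : Euc2) (h1 : 0 < y 1) (h0 : nuf θ₀ y = 0) :
    polarAngle2 y = θ₀ := by
  have hy := norm_pos_of y h1
  rw [nuf_eq _ _ h1.le hy] at h0
  obtain ⟨h, h'⟩ := polar_bounds y h1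
  obtain ⟨t0, t1⟩ := hθ₀
  have hs : Real.sin (θ₀ - polarAngle2 y) = 0 := by
    rcases mul_eq_zero.1 h0 with h | h
    · linarith
    · exact h
  have := (Real.sin_eq_zero_iff_of_lt_of_lt (by linarith) (by linarith)).1 hs
  linarith

lemma omega_pos {R θ₀ : ℝ} (hθ₀ : θ₀ ∈ Ioo 0 π) {y : Euc2} (h : y ∈ omega2 R θ₀) :
    0 < nuf θ₀ y := by
  obtain ⟨a, b, c, d⟩ := h
  rw [nuf_eq _ _ a b]
  have h0 : 0 ≤ polarAngle2 y := Real.arccos_nonneg _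
  exact mul_pos b (Real.sin_pos_of_pos_of_lt_pi (by linarith) (by linarith [hθ₀.2]))

lemma omegaO_iff {R θ₀ : ℝ} (hθ₀ : θ₀ ∈ Ioo 0 π) {y : Euc2} :
    y ∈ omega2O R θ₀ ↔ 0 < y 1 ∧ ‖y‖ < R ∧ 0 < nuf θ₀ y := by
  constructor
  · rintro ⟨a, b, c⟩
    exact ⟨a, b, (nuf_pos_iff hθ₀ y a).2 c⟩
  · rintro ⟨a, b, c⟩
    exact ⟨a, b, (nuf_pos_iff hθ₀ y a).1 c⟩

lemma omegaO_open {R θ₀ : ℝ} (hθ₀ : θ₀ ∈ Ioo 0 π) : IsOpen (omega2O R θ₀) := by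
  have : omega2O R θ₀ = {y | 0 < y 1} ∩ ({y | ‖y‖ < R} ∩ {y | 0 < nuf θ₀ y}) := by
    ext y; rw [omegaO_iff hθ₀]; rfl
  rw [this]
  refine (isOpen_lt continuous_const (by fun_prop)).inter
    ((isOpen_lt (by fun_prop) continuous_const).inter (isOpen_lt continuous_const (nuf_cont θ₀)))

lemma omegaO_sub {R θ₀ : ℝ} : omega2O R θ₀ ⊆ omega2 R θ₀ := by
  rintro y ⟨a, b, c⟩
  exact ⟨a.le, norm_pos_of y a, b, c⟩

lemma closure_props {R θ₀ : ℝ} (hθ₀ : θ₀ ∈ Ioo 0 π) {y : Euc2} (h : y ∈ closure (omega2 R θ₀)) :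
    0 ≤ y 1 ∧ ‖y‖ ≤ R ∧ 0 ≤ nuf θ₀ y := by
  have hc : IsClosed ({y : Euc2 | 0 ≤ y 1} ∩ ({y | ‖y‖ ≤ R} ∩ {y | 0 ≤ nuf θ₀ y})) :=
    (isClosed_le continuous_const (by fun_prop)).inter
    ((isClosed_le (by fun_prop) continuous_const).inter (isClosed_le continuous_const (nuf_cont θ₀)))
  refine closure_minimal ?_ hc h
  intro z hz
  exact ⟨hz.1, hz.2.2.1.le, (omega_pos hθ₀ hz).le⟩

lemma path_closure {s : Set Euc2} (c : ℝ → Euc2) (hc : ContinuousAt c 0)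
    (h : ∀ᶠ t in 𝓝[>] (0:ℝ), c t ∈ s) : c 0 ∈ closure s :=
  mem_closure_of_tendsto (hc.tendsto.mono_left nhdsWithin_le_nhds) h

lemma nuVec0 (θ₀ : ℝ) : nuVec θ₀ 0 = Real.sin θ₀ := by simp [nuVec, vec2]
lemma nuVec1 (θ₀ : ℝ) : nuVec θ₀ 1 = -Real.cos θ₀ := by simp [nuVec, vec2]
lemma tauVec0 (θ₀ : ℝ) : tauVec θ₀ 0 = -Real.cos θ₀ := by simp [tauVec, vec2]
lemma tauVec1 (θ₀ : ℝ) : tauVec θ₀ 1 = -Real.sin θ₀ := by simp [tauVec, vec2]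

lemma nuf_add_nu (θ₀ t : ℝ) (y : Euc2) : nuf θ₀ (y + t • nuVec θ₀) = nuf θ₀ y + t := by
  simp only [nuf, PiLp.add_apply, PiLp.smul_apply, nuVec0, nuVec1, smul_eq_mul]
  linear_combination t * Real.sin_sq_add_cos_sq θ₀

lemma nuf_add_tau (θ₀ t : ℝ) (y : Euc2) : nuf θ₀ (y + t • tauVec θ₀) = nuf θ₀ y := by
  simp only [nuf, PiLp.add_apply, PiLp.smul_apply, tauVec0, tauVec1, smul_eq_mul]
  ring

lemma ev_line {R : ℝ} (y w : Euc2) (h1 : 0 < y 1) (hR : ‖y‖ < R) :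
    ∀ᶠ t in 𝓝 (0:ℝ), 0 < (y + t • w) 1 ∧ ‖y + t • w‖ < R := by
  have hc : Continuous fun t : ℝ => y + t • w := by fun_prop
  have e1 : ∀ᶠ t in 𝓝 (0:ℝ), 0 < (y + t • w) 1 := by
    refine ContinuousAt.eventually_lt (f := fun _ => (0:ℝ)) (g := fun t : ℝ => (y + t • w) 1) continuousAt_const ?_ (by simpa using h1)
    have : Continuous fun t : ℝ => (y + t • w) 1 := by fun_prop
    exact this.continuousAt
  have e2 : ∀ᶠ t in 𝓝 (0:ℝ), ‖y + t • w‖ < R := by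
    refine ContinuousAt.eventually_lt (f := fun t : ℝ => ‖y + t • w‖) (g := fun _ => R) ?_ continuousAt_const (by simpa using hR)
    exact hc.norm.continuousAt
  exact e1.and e2

lemma mem_closure_of {R θ₀ : ℝ} (hθ₀ : θ₀ ∈ Ioo 0 π) {y : Euc2} (h1 : 0 < y 1) (hR : ‖y‖ < R)
    (hn : 0 ≤ nuf θ₀ y) : y ∈ closure (omega2 R θ₀) := by
  have := path_closure (s := omega2 R θ₀) (fun t => y + t • nuVec θ₀) (by fun_prop) (by
    filter_upwards [nhdsWithin_le_nhds (ev_line y (nuVec θ₀) h1 hR), self_mem_nhdsWithin] with t ht ht0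
    refine omegaO_sub ((omegaO_iff hθ₀).2 ⟨ht.1, ht.2, ?_⟩)
    rw [nuf_add_nu]
    have : (0:ℝ) < t := ht0
    linarith)
  simpa using this

lemma mem_ball_closure {R θ₀ : ℝ} (hR : 0 < R) (hθ₀ : θ₀ ∈ Ioo 0 π) {y : Euc2} (h1 : 0 < y 1) (hyR : ‖y‖ = R)
    (hn : 0 ≤ nuf θ₀ y) : y ∈ closure (gammaBall2 R θ₀) := by
  have := path_closure (s := gammaBall2 R θ₀)
    (fun t => (R / ‖y + t • nuVec θ₀‖) • (y + t • nuVec θ₀)) (by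
      have hc : ContinuousAt (fun t : ℝ => y + t • nuVec θ₀) 0 := by fun_prop
      refine ContinuousAt.smul (ContinuousAt.div continuousAt_const hc.norm ?_) hc
      simp only [zero_smul, add_zero]; rw [hyR]; exact hR.ne') (by
    filter_upwards [nhdsWithin_le_nhds (ev_line (R := R + 1) y (nuVec θ₀) h1 (by linarith)), self_mem_nhdsWithin] with t ht ht0
    have hp := norm_pos_of _ ht.1
    have hn2 : 0 < nuf θ₀ (y + t • nuVec θ₀) := by
      rw [nuf_add_nu]
      have : (0:ℝ) < t := ht0
      linarith
    generalize y + t • nuVec θ₀ = z at *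
    have h1' : 0 < ((R / ‖z‖) • z) 1 := by
      simp only [PiLp.smul_apply, smul_eq_mul]
      exact mul_pos (by positivity) ht.1
    refine ⟨?_, h1', (nuf_pos_iff hθ₀ _ h1').1 ?_⟩
    · rw [norm_smul, Real.norm_eq_abs, abs_of_pos (by positivity)]; field_simp
    · have : nuf θ₀ ((R / ‖z‖) • z) = (R / ‖z‖) * nuf θ₀ z := by
        simp only [nuf, PiLp.smul_apply, smul_eq_mul]; ring
      rw [this]; positivity)
  simp only [zero_smul, add_zero] at this
  rwa [hyR, div_self hR.ne', one_smul] at this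

lemma omega_sub_closure {R θ₀ : ℝ} (hθ₀ : θ₀ ∈ Ioo 0 π) : closure (omega2 R θ₀) ⊆ closure (omega2O R θ₀) := by
  refine closure_minimal ?_ isClosed_closure
  intro y hy
  have hp := omega_pos hθ₀ hy
  have hc : Continuous fun t : ℝ => y + t • (EuclideanSpace.single 1 1 : Euc2) := by fun_prop
  have := path_closure (s := omega2O R θ₀) (fun t => y + t • (EuclideanSpace.single 1 1 : Euc2)) hc.continuousAt (by
    have e1 : ∀ᶠ t in 𝓝 (0:ℝ), ‖y + t • (EuclideanSpace.single 1 1 : Euc2)‖ < R := by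
      refine ContinuousAt.eventually_lt (g := fun _ => R) hc.norm.continuousAt continuousAt_const (by simpa using hy.2.2.1)
    have e2 : ∀ᶠ t in 𝓝 (0:ℝ), 0 < nuf θ₀ (y + t • (EuclideanSpace.single 1 1 : Euc2)) := by
      refine ContinuousAt.eventually_lt (f := fun _ => (0:ℝ)) continuousAt_const ((nuf_cont θ₀).comp hc).continuousAt (by simpa using hp)
    filter_upwards [nhdsWithin_le_nhds e1, nhdsWithin_le_nhds e2, self_mem_nhdsWithin] with t h1 h2 h3
    refine (omegaO_iff hθ₀).2 ⟨?_, h1, h2⟩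
    have h4 : (0:ℝ) < t := h3
    have := hy.1
    simp; linarith)
  simpa using this

lemma second_deriv_nonneg (f : ℝ → ℝ) (hmin : IsLocalMin f 0) (hc : ContinuousAt f 0) :
    0 ≤ deriv (deriv f) 0 := by
  by_contra h
  push Not at h
  have hd := hmin.deriv_eq_zero
  have hmax := isLocalMax_of_deriv_deriv_neg h hd hc
  have hconst : f =ᶠ[𝓝 0] fun _ => f 0 := by
    filter_upwards [hmin, hmax] with x h1 h2 using le_antisymm h2 h1
  have h1 : deriv f =ᶠ[𝓝 0] deriv (fun _ => f 0) := hconst.deriv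
  rw [h1.deriv_eq] at h
  simp at h

def gf (R t : ℝ) : ℝ := Real.log R - Real.log t - t ^ 2

lemma gf_deriv (R : ℝ) {t : ℝ} (ht : 0 < t) : HasDerivAt (gf R) (-t⁻¹ - 2 * t) t := by
  unfold gf
  have := ((Real.hasDerivAt_log ht.ne').const_sub (Real.log R)).sub ((hasDerivAt_id t).pow 2)
  exact HasDerivAt.congr_deriv this (by simp)

lemma gf_deriv2 {t : ℝ} (ht : 0 < t) :
    HasDerivAt (fun t : ℝ => -t⁻¹ - 2 * t) ((t ^ 2)⁻¹ - 2) t := by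
  have := (hasDerivAt_inv ht.ne').neg.sub ((hasDerivAt_id t).const_mul 2)
  exact HasDerivAt.congr_deriv this (by simp)

lemma gf_tendsto (R : ℝ) : Tendsto (gf R) (𝓝[>] 0) atTop := by
  have h1 : Tendsto (fun t => - Real.log t) (𝓝[>] (0:ℝ)) atTop :=
    tendsto_neg_atBot_atTop.comp Real.tendsto_log_nhdsGT_zero
  have h2 : Tendsto (fun t : ℝ => Real.log R - t ^ 2) (𝓝[>] (0:ℝ)) (𝓝 (Real.log R - 0 ^ 2)) := by
    have : Continuous (fun t : ℝ => Real.log R - t ^ 2) := by fun_prop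
    exact this.continuousAt.tendsto.mono_left nhdsWithin_le_nhds
  refine (h2.add_atTop h1).congr fun t => ?_
  unfold gf; ring

/-- line restriction facts -/
lemma line_facts {U : Set Euc2} (hU : IsOpen U) {u : Euc2 → ℝ} (hu : ContDiffOn ℝ 2 u U)
    {y : Euc2} (hy : y ∈ U) (i : Fin 2) :
    (∀ᶠ t in 𝓝 (0:ℝ), HasDerivAt (fun t : ℝ => u (y + t • (EuclideanSpace.single i 1 : Euc2)))
      (pdy i u (y + t • (EuclideanSpace.single i 1 : Euc2))) t) ∧
    HasDerivAt (fun t : ℝ => pdy i u (y + t • (EuclideanSpace.single i 1 : Euc2))) (pdy₂ i i u y) 0 := by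
  have hl : ∀ t : ℝ, HasDerivAt (fun t : ℝ => y + t • (EuclideanSpace.single i 1 : Euc2))
      (EuclideanSpace.single i 1 : Euc2) t := by
    intro t
    simpa using ((hasDerivAt_id t).smul_const (EuclideanSpace.single i 1 : Euc2)).const_add y
  constructor
  · have hc : Continuous fun t : ℝ => y + t • (EuclideanSpace.single i 1 : Euc2) := by fun_prop
    have : ∀ᶠ t in 𝓝 (0:ℝ), y + t • (EuclideanSpace.single i 1 : Euc2) ∈ U :=
      hc.continuousAt.eventually_mem (by simpa using hU.mem_nhds hy)
    filter_upwards [this] with t ht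
    have hd : DifferentiableAt ℝ u (y + t • (EuclideanSpace.single i 1 : Euc2)) :=
      (hu.contDiffAt (hU.mem_nhds ht)).differentiableAt (by norm_num)
    exact hd.hasFDerivAt.comp_hasDerivAt t (hl t)
  · have h1 : ContDiffOn ℝ 1 (fderiv ℝ u) U := hu.fderiv_of_isOpen hU (by norm_num)
    have h2 : DifferentiableAt ℝ (fderiv ℝ u) y :=
      (h1.contDiffAt (hU.mem_nhds hy)).differentiableAt (by norm_num)
    have h3 : DifferentiableAt ℝ (pdy i u) y := by
      unfold pdy; exact h2.clm_apply (differentiableAt_const _)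
    have h4 : HasFDerivAt (pdy i u) (fderiv ℝ (pdy i u) y) (y + (0:ℝ) • (EuclideanSpace.single i 1 : Euc2)) := by
      simpa using h3.hasFDerivAt
    exact h4.comp_hasDerivAt (0:ℝ) (hl 0)

lemma interior_contra (n : ℕ) (hn : 3 ≤ n) {U : Set Euc2} (hU : IsOpen U)
    (a₁ a₂ : ℝ) (ha₁ : 0 < a₁) (ha₂ : 0 < a₂) {u : Euc2 → ℝ} (hu : ContDiffOn ℝ 2 u U)
    {y : Euc2} (hy : y ∈ U) (hy1 : 0 < y 1) (R δ : ℝ) (hδ : 0 < δ)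
    (hmin : IsLocalMin (fun z : Euc2 => u z + δ * gf R (z 1)) y) : 0 < Lop n a₁ a₂ u y := by
  have hline : ∀ i : Fin 2, Tendsto (fun t : ℝ => y + t • (EuclideanSpace.single i 1 : Euc2)) (𝓝 0) (𝓝 y) := by
    intro i
    have hc : Continuous fun t : ℝ => y + t • (EuclideanSpace.single i 1 : Euc2) := by fun_prop
    simpa using hc.tendsto 0
  -- direction 0
  have h00 : 0 ≤ pdy₂ 0 0 u y := by
    obtain ⟨e1, e2⟩ := line_facts hU hu hy 0
    have hm : IsLocalMin (fun t : ℝ => u (y + t • (EuclideanSpace.single 0 1 : Euc2))) 0 := by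
      have := (hline 0).eventually hmin
      filter_upwards [this] with t ht
      simpa using ht
    have := second_deriv_nonneg _ hm e1.self_of_nhds.continuousAt
    have hd : deriv (fun t : ℝ => u (y + t • (EuclideanSpace.single 0 1 : Euc2))) =ᶠ[𝓝 0]
        fun t : ℝ => pdy 0 u (y + t • (EuclideanSpace.single 0 1 : Euc2)) := by
      filter_upwards [e1] with t ht using ht.deriv
    rwa [hd.deriv_eq, e2.deriv] at this
  obtain ⟨e1, e2⟩ := line_facts hU hu hy 1
  have hm : IsLocalMin (fun t : ℝ => u (y + t • (EuclideanSpace.single 1 1 : Euc2)) + δ * gf R (y 1 + t)) 0 := by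
    have := (hline 1).eventually hmin
    filter_upwards [this] with t ht
    simpa using ht
  have hpos : ∀ᶠ t in 𝓝 (0:ℝ), 0 < y 1 + t := by
    refine ContinuousAt.eventually_lt (f := fun _ => (0:ℝ)) continuousAt_const (by fun_prop) (by simpa using hy1)
  have e3 : ∀ᶠ t in 𝓝 (0:ℝ), HasDerivAt (fun t : ℝ => u (y + t • (EuclideanSpace.single 1 1 : Euc2)) + δ * gf R (y 1 + t))
      (pdy 1 u (y + t • (EuclideanSpace.single 1 1 : Euc2)) + δ * (-(y 1 + t)⁻¹ - 2 * (y 1 + t))) t := by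
    filter_upwards [e1, hpos] with t h1 h2
    exact h1.add (((gf_deriv R h2).comp_const_add (y 1) t).const_mul δ)
  have e4 : HasDerivAt (fun t : ℝ => pdy 1 u (y + t • (EuclideanSpace.single 1 1 : Euc2)) + δ * (-(y 1 + t)⁻¹ - 2 * (y 1 + t)))
      (pdy₂ 1 1 u y + δ * (((y 1) ^ 2)⁻¹ - 2)) 0 := by
    have := e2.add ((HasDerivAt.comp_const_add (y 1) 0 (gf_deriv2 (t := y 1 + 0) (by simpa using hy1))).const_mul δ)
    exact HasDerivAt.congr_deriv this (by simp)
  have hd : deriv (fun t : ℝ => u (y + t • (EuclideanSpace.single 1 1 : Euc2)) + δ * gf R (y 1 + t)) =ᶠ[𝓝 0]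
      fun t : ℝ => pdy 1 u (y + t • (EuclideanSpace.single 1 1 : Euc2)) + δ * (-(y 1 + t)⁻¹ - 2 * (y 1 + t)) := by
    filter_upwards [e3] with t ht using ht.deriv
  have h11 := second_deriv_nonneg _ hm e3.self_of_nhds.continuousAt
  rw [hd.deriv_eq, e4.deriv] at h11
  have h1 := hm.deriv_eq_zero
  rw [hd.self_of_nhds] at h1
  simp only [zero_smul, add_zero] at h1
  have hp1 : pdy 1 u y = δ * ((y 1)⁻¹ + 2 * y 1) := by linarith
  unfold Lop
  rw [hp1]
  have hn' : (3:ℝ) ≤ n := by exact_mod_cast hn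
  have hq : pdy₂ 1 1 u y ≥ -(δ * (((y 1) ^ 2)⁻¹ - 2)) := by linarith
  have : ((n : ℝ) - 2) * a₂ / y 1 * (δ * ((y 1)⁻¹ + 2 * y 1)) = a₂ * (δ * ((n - 2) * ((y 1) ^ 2)⁻¹ + 2 * (n - 2))) := by
    field_simp
  rw [this]
  have hi : 0 < ((y 1) ^ 2)⁻¹ := by positivity
  generalize ((y 1) ^ 2)⁻¹ = s at *
  have h3 : 0 < a₂ * (pdy₂ 1 1 u y + δ * (((n:ℝ) - 2) * s + 2 * (n - 2))) := by
    refine mul_pos ha₂ ?_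
    have : 0 < δ * (((n:ℝ) - 2) * s + 2 * (n - 2) - (s - 2)) := by
      refine mul_pos hδ ?_
      nlinarith
    nlinarith
  have := mul_nonneg ha₁.le h00
  nlinarith

lemma cone_step {R θ₀ : ℝ} (hθ₀ : θ₀ ∈ Ioo 0 π)
    (β₁ β₂ atil btil : ℝ) (hbtil : 0 < btil)
    (hoblique : 0 < β₁ * Real.sin θ₀ + β₂ * (-Real.cos θ₀))
    (u : Euc2 → ℝ)
    (hu1 : ContDiffOn ℝ 1 u (closure (omega2 R θ₀) \ {0}))
    {y : Euc2} (hy1 : 0 < y 1) (hyR : ‖y‖ < R) (hyn : nuf θ₀ y = 0)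
    (hcone :
      fderivWithin ℝ u (closure (omega2 R θ₀)) y (vec2 β₁ β₂)
        + atil * fderivWithin ℝ u (closure (omega2 R θ₀)) y (tauVec θ₀)
        - btil / y 1 * u y ≤ 0) (δ : ℝ) (hδ : 0 < δ)
    (hmin : IsLocalMinOn (fun z : Euc2 => u z + δ * gf R (z 1)) (closure (omega2 R θ₀)) y) :
    - (δ * ((1 + 2 * R ^ 2) * |β₂ - atil * Real.sin θ₀| / btil)) ≤ u y := by
  set S := closure (omega2 R θ₀) with hS
  have hyS : y ∈ S := mem_closure_of hθ₀ hy1 hyR hyn.ge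
  have hy0 : y ≠ 0 := fun h => by rw [h] at hy1; simp at hy1
  have hdiff : DifferentiableWithinAt ℝ u S y := by
    have h := (hu1 y ⟨hyS, hy0⟩).differentiableWithinAt (by norm_num)
    have : S \ {0} ∈ 𝓝[S] y :=
      Filter.inter_mem self_mem_nhdsWithin (nhdsWithin_le_nhds (isOpen_compl_singleton.mem_nhds hy0))
    exact h.mono_of_mem_nhdsWithin this
  set Du := fderivWithin ℝ u S y with hDu
  have hproj : HasFDerivAt (fun z : Euc2 => z 1) (EuclideanSpace.proj 1 : Euc2 →L[ℝ] ℝ) y :=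
    (EuclideanSpace.proj 1 : Euc2 →L[ℝ] ℝ).hasFDerivAt
  have hg : HasFDerivAt (fun z : Euc2 => δ * gf R (z 1))
      (δ • ((-(y 1)⁻¹ - 2 * y 1) • (EuclideanSpace.proj 1 : Euc2 →L[ℝ] ℝ))) y := by
    have h := (gf_deriv R hy1).comp_hasFDerivAt (f := fun z : Euc2 => z 1) y hproj
    exact h.const_mul δ
  have hD := hdiff.hasFDerivWithinAt.add hg.hasFDerivWithinAt (s := S)
  have key : ∀ w : Euc2, (∀ t : ℝ, 0 < t → 0 ≤ nuf θ₀ (y + t • w)) →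
      0 ≤ Du w + δ * ((-(y 1)⁻¹ - 2 * y 1) * w 1) := by
    intro w hw
    have hmem : w ∈ posTangentConeAt S y := by
      refine mem_posTangentConeAt_of_frequently_mem (Eventually.frequently ?_)
      filter_upwards [nhdsWithin_le_nhds (ev_line y w hy1 hyR), self_mem_nhdsWithin] with t ht ht0
      exact mem_closure_of hθ₀ ht.1 ht.2 (hw t ht0)
    have := IsLocalMinOn.hasFDerivWithinAt_nonneg hmin hD hmem
    simpa using this
  have k1 := key (nuVec θ₀) (fun t ht => by rw [nuf_add_nu]; linarith)
  have k2 := key (tauVec θ₀) (fun t ht => by rw [nuf_add_tau]; linarith)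
  have k3 := key (-tauVec θ₀) (fun t ht => by
    have := nuf_add_tau θ₀ (-t) y
    rw [neg_smul, ← smul_neg] at this
    rw [this]; linarith)
  rw [map_neg, PiLp.neg_apply] at k3
  have hvec : vec2 β₁ β₂ = (β₁ * Real.sin θ₀ + β₂ * (-Real.cos θ₀)) • nuVec θ₀
      + (β₁ * (-Real.cos θ₀) + β₂ * (-Real.sin θ₀)) • tauVec θ₀ := by
    have hs := Real.sin_sq_add_cos_sq θ₀
    ext i
    fin_cases i
    · simp [vec2, nuVec0, tauVec0]
      linear_combination (-β₁) * hs
    · simp [vec2, nuVec1, tauVec1]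
      linear_combination (-β₂) * hs
  rw [hvec, map_add, map_smul, map_smul, smul_eq_mul, smul_eq_mul] at hcone
  rw [nuVec1] at k1
  rw [tauVec1] at k2 k3
  have ht : Du (tauVec θ₀) = - (δ * ((-(y 1)⁻¹ - 2 * y 1) * -Real.sin θ₀)) := by linarith
  rw [ht] at hcone
  have k1' := mul_le_mul_of_nonneg_left k1 hoblique.le
  have hs := Real.sin_sq_add_cos_sq θ₀
  set p := β₂ - atil * Real.sin θ₀ with hp
  have main : δ * ((y 1)⁻¹ + 2 * y 1) * p ≤ btil / y 1 * u y := by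
    have : δ * ((y 1)⁻¹ + 2 * y 1) * p = δ * ((y 1)⁻¹ + 2 * y 1) * (β₂ * (Real.sin θ₀ ^ 2 + Real.cos θ₀ ^ 2) - atil * Real.sin θ₀) := by
      rw [hs, hp]; ring
    rw [this]
    nlinarith
  have hyle : y 1 ^ 2 ≤ R ^ 2 := by
    have := nsq y
    have h2 : ‖y‖ ^ 2 ≤ R ^ 2 := by gcongr
    nlinarith [sq_nonneg (y 0)]
  have m2 : δ * (1 + 2 * y 1 ^ 2) * p ≤ btil * u y := by
    have := mul_le_mul_of_nonneg_left main hy1.le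
    have e1 : y 1 * (δ * ((y 1)⁻¹ + 2 * y 1) * p) = δ * (1 + 2 * y 1 ^ 2) * p := by field_simp
    have e2 : y 1 * (btil / y 1 * u y) = btil * u y := by field_simp
    rwa [e1, e2] at this
  have m3 : -(δ * ((1 + 2 * R ^ 2) * |p|)) ≤ btil * u y := by
    refine le_trans ?_ m2
    have h1 : -|p| ≤ p := neg_abs_le p
    have h2 : δ * (1 + 2 * y 1 ^ 2) * (-|p|) ≤ δ * (1 + 2 * y 1 ^ 2) * p := by gcongr
    have h3 : δ * (1 + 2 * y 1 ^ 2) * |p| ≤ δ * (1 + 2 * R ^ 2) * |p| := by gcongr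
    linarith
  have : -(δ * ((1 + 2 * R ^ 2) * |p| / btil)) = (-(δ * ((1 + 2 * R ^ 2) * |p|))) / btil := by ring
  rw [this, div_le_iff₀ hbtil]
  linarith

theorem comparison_principle_first_version
    (n : ℕ) (hn : 3 ≤ n) (R θ₀ : ℝ) (hR : 0 < R) (hθ₀ : θ₀ ∈ Ioo 0 π)
    (a₁ a₂ : ℝ) (ha₁ : 0 < a₁) (ha₂ : 0 < a₂)
    (β₁ β₂ atil btil : ℝ) (hbtil : 0 < btil)
    (hoblique : 0 < β₁ * Real.sin θ₀ + β₂ * (-Real.cos θ₀))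
    (u : Euc2 → ℝ)
    (hu2 : ContDiffOn ℝ 2 u (omega2O R θ₀))
    (hu1 : ContDiffOn ℝ 1 u (closure (omega2 R θ₀) \ {0}))
    (hu0 : ContinuousOn u (closure (omega2 R θ₀)))
    (hPDE : ∀ y ∈ omega2O R θ₀, Lop n a₁ a₂ u y ≤ 0)
    (hsymm : ∀ y ∈ gammaSymm2 R,
      fderivWithin ℝ u (closure (omega2 R θ₀)) y (EuclideanSpace.single 1 1) = 0)
    (hcone : ∀ y ∈ gammaCone2 R θ₀,
      fderivWithin ℝ u (closure (omega2 R θ₀)) y (vec2 β₁ β₂)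
        + atil * fderivWithin ℝ u (closure (omega2 R θ₀)) y (tauVec θ₀)
        - btil / y 1 * u y ≤ 0)
    (hball : ∀ y ∈ closure (gammaBall2 R θ₀), 0 ≤ u y)
    (hvertex : u 0 = 0) :
    ∀ y ∈ closure (omega2 R θ₀), 0 ≤ u y := by
  set S := closure (omega2 R θ₀) with hS
  have hScomp : IsCompact S := by
    refine (isCompact_closedBall (0 : Euc2) R).of_isClosed_subset isClosed_closure ?_
    intro y hy
    simpa using (closure_props hθ₀ hy).2.1
  set C := (1 + 2 * R ^ 2) * |β₂ - atil * Real.sin θ₀| / btil + R ^ 2 with hC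
  have hC0 : 0 ≤ (1 + 2 * R ^ 2) * |β₂ - atil * Real.sin θ₀| / btil := by positivity
  have gbound : ∀ y ∈ S, 0 < y 1 → -R ^ 2 ≤ gf R (y 1) := by
    intro y hy hy1
    have hyR := (closure_props hθ₀ hy).2.1
    have hy2 : y 1 ^ 2 ≤ R ^ 2 := by
      have := nsq y
      have h2 : ‖y‖ ^ 2 ≤ R ^ 2 := by gcongr
      nlinarith [sq_nonneg (y 0)]
    have hle : y 1 ≤ R := le_of_sq_le_sq hy2 hR.le
    have := Real.log_le_log hy1 hle
    unfold gf; linarith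
  have main : ∀ δ : ℝ, 0 < δ → ∀ y ∈ S, 0 < y 1 → -(δ * C) ≤ u y + δ * gf R (y 1) := by
    intro δ hδ z hz hz1
    obtain ⟨x0, hx0, hx0m⟩ := hScomp.exists_isMinOn ⟨z, hz⟩ hu0
    set v : Euc2 → ℝ := fun z => u z + δ * gf R (z 1) with hv
    have ev : ∀ᶠ t in 𝓝[>] (0:ℝ), v z ≤ u x0 + δ * gf R t := by
      have : Tendsto (fun t => u x0 + δ * gf R t) (𝓝[>] 0) atTop :=
        tendsto_atTop_add_const_left _ _ ((gf_tendsto R).const_mul_atTop hδ)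
      exact this.eventually_ge_atTop _
    obtain ⟨t0, ht0, ht0'⟩ := mem_nhdsGT_iff_exists_Ioo_subset.1 ev
    have ht0 : 0 < t0 := ht0
    set s0 := min t0 (z 1) with hs0
    have hs0p : 0 < s0 := lt_min ht0 hz1
    have hK : IsCompact (S ∩ {y : Euc2 | s0 ≤ y 1}) :=
      hScomp.inter_right (isClosed_le continuous_const (by fun_prop))
    have hzK : z ∈ S ∩ {y : Euc2 | s0 ≤ y 1} := ⟨hz, show s0 ≤ z 1 from min_le_right _ _⟩
    have hvc : ContinuousOn v (S ∩ {y : Euc2 | s0 ≤ y 1}) := by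
      refine (hu0.mono inter_subset_left).add (ContinuousOn.const_smul (c := δ) (g := fun z : Euc2 => gf R (z 1)) ?_)
      intro y hy
      have : ContinuousAt (gf R) (y 1) := (gf_deriv R (lt_of_lt_of_le hs0p hy.2)).continuousAt
      have h2 : ContinuousAt (fun z : Euc2 => z 1) y := by fun_prop
      exact (ContinuousAt.comp (f := fun z : Euc2 => z 1) this h2).continuousWithinAt
    obtain ⟨y, hyK, hym⟩ := hK.exists_isMinOn ⟨z, hzK⟩ hvc
    have hyz : v y ≤ v z := hym hzK
    have hy1 : 0 < y 1 := lt_of_lt_of_le hs0p hyK.2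
    have hyS : y ∈ S := hyK.1
    have hglob : ∀ w ∈ S, 0 < w 1 → v y ≤ v w := by
      intro w hw hw1
      by_cases h : s0 ≤ w 1
      · exact hym ⟨hw, h⟩
      · push Not at h
        have h1 : v z ≤ u x0 + δ * gf R (w 1) := ht0' ⟨hw1, lt_of_lt_of_le h (min_le_left _ _)⟩
        have h2 : u x0 ≤ u w := hx0m hw
        have : v w = u w + δ * gf R (w 1) := rfl
        linarith
    have hpos : ∀ᶠ w in 𝓝 y, 0 < w 1 :=
      (isOpen_lt (f := fun _ : Euc2 => (0:ℝ)) (g := fun w : Euc2 => w 1) continuous_const (by fun_prop)).mem_nhds hy1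
    refine le_trans ?_ hyz
    have hgy := mul_le_mul_of_nonneg_left (gbound y hyS hy1) hδ.le
    have hvy : v y = u y + δ * gf R (y 1) := rfl
    have huy : -(δ * ((1 + 2 * R ^ 2) * |β₂ - atil * Real.sin θ₀| / btil)) ≤ u y := by
      obtain ⟨-, hyR, hyn⟩ := closure_props hθ₀ hyS
      rcases hyR.eq_or_lt with hyR | hyR
      · have := hball y (mem_ball_closure hR hθ₀ hy1 hyR hyn)
        have := mul_nonneg hδ.le hC0
        linarith
      rcases hyn.eq_or_lt with hyn | hyn
      · refine cone_step hθ₀ β₁ β₂ atil btil hbtil hoblique u hu1 hy1 hyR hyn.symm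
          (hcone y ⟨hy1.le, norm_pos_of y hy1, hyR, nuf_zero hθ₀ y hy1 hyn.symm⟩) δ hδ ?_
        filter_upwards [nhdsWithin_le_nhds hpos, self_mem_nhdsWithin] with w h1 h2 using hglob w h2 h1
      · exfalso
        have hyO : y ∈ omega2O R θ₀ := (omegaO_iff hθ₀).2 ⟨hy1, hyR, hyn⟩
        have := interior_contra n hn (omegaO_open hθ₀) a₁ a₂ ha₁ ha₂ hu2 hyO hy1 R δ hδ (by
          filter_upwards [(omegaO_open hθ₀).mem_nhds hyO] with w hw
          exact hglob w (subset_closure (omegaO_sub hw)) hw.1)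
        linarith [hPDE y hyO]
    rw [hC]
    linarith
  have pos : ∀ y ∈ omega2O R θ₀, 0 ≤ u y := by
    intro y hy
    have hyS : y ∈ S := subset_closure (omegaO_sub hy)
    have hlim : Tendsto (fun δ : ℝ => u y + δ * gf R (y 1) + δ * C) (𝓝[>] 0) (𝓝 (u y + 0 * gf R (y 1) + 0 * C)) := by
      have : Continuous (fun δ : ℝ => u y + δ * gf R (y 1) + δ * C) := by fun_prop
      exact (this.tendsto 0).mono_left nhdsWithin_le_nhds
    have : 0 ≤ u y + 0 * gf R (y 1) + 0 * C := by
      refine ge_of_tendsto hlim ?_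
      filter_upwards [self_mem_nhdsWithin] with δ hδ
      have := main δ hδ y hyS hy.1
      linarith
    linarith
  intro y hy
  exact le_on_closure (f := fun _ => (0:ℝ)) (g := u) pos continuousOn_const
    (hu0.mono (closure_mono omegaO_sub)) (omega_sub_closure hθ₀ hy)
end
end
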